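/- arXiv:1301.6432 — 5 statements merged into one kernel-verified Lean document; each statement's English description precedes it below -/
import Mathlib

section
/- Let 0 < a_1 ≤ a_2 ≤ ... ≤ a_n and let z ∈ ℂ \ (-∞, -a_1]. Then the principal branch of the geometric mean satisfies the integral representation: exp((1/n)∑_{k=1}^n Log(a_k + z)) = A_n(a) + z - (1/π)∑_{ℓ=1}^{n-1} sin(ℓπ/n) ∫_{a_ℓ}^{a_{ℓ+1}} (∏_{k=1}^n |a_k - t|)^{1/n} · dt/(t + z), where A_n(a) = (1/n)∑_{k=1}^n a_k. -/
open Finset Filter Real Complex intervalIntegral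
open scoped Topology ComplexConjugate

/-- A function holomorphic on the upper half-plane, continuous up to the boundary and `o(1 / w)` at
infinity has vanishing principal-value integral along the real line. -/
theorem tendsto_integral_boundary_of_upperHalfPlane {Q : ℂ → ℂ} {s : Set ℂ} (hs : s.Countable)
    (hc : ContinuousOn Q {w | 0 ≤ w.im})
    (hd : ∀ w : ℂ, 0 < w.im → w ∉ s → DifferentiableAt ℂ Q w)
    (hlim : Tendsto (fun w => w * Q w) (Bornology.cobounded ℂ ⊓ 𝓟 {w | 0 ≤ w.im}) (𝓝 0)) :
    Tendsto (fun R : ℝ => ∫ t in (-R)..R, Q t) atTop (𝓝 0) := by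
  rw [Metric.tendsto_nhds]
  intro ε hε
  have h1 := (Metric.tendsto_nhds.1 hlim) (ε / 8) (by positivity)
  rw [eventually_inf_principal] at h1
  obtain ⟨M, -, hM⟩ := ((hasBasis_cobounded_norm (E := ℂ)).eventually_iff).1 h1
  filter_upwards [eventually_ge_atTop (max M 1)] with R hR
  have hR1 : 1 ≤ R := (le_max_right _ _).trans hR
  have hRM : M ≤ R := (le_max_left _ _).trans hR
  have hR0 : 0 < R := by linarith
  have key : ∀ w : ℂ, 0 ≤ w.im → R ≤ ‖w‖ → ‖Q w‖ ≤ ε / 8 / R := by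
    intro w hw hwR
    have h := hM (show M ≤ ‖w‖ from hRM.trans hwR) hw
    rw [dist_zero_right, norm_mul] at h
    rw [le_div_iff₀ hR0]
    nlinarith [norm_nonneg (Q w)]
  have hrect := integral_boundary_rect_eq_zero_of_differentiable_on_off_countable Q
    (⟨-R, 0⟩ : ℂ) (⟨R, R⟩ : ℂ) s hs
    (hc.mono (by
      intro w hw
      rw [mem_reProdIm, Set.uIcc_of_le (by simp; linarith), Set.uIcc_of_le (by simp; linarith)] at hw
      exact hw.2.1))
    (by
      intro w hw
      rw [Set.mem_sdiff, mem_reProdIm] at hw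
      refine hd w ?_ hw.2
      have := hw.1.2.1
      simpa [hR0.le] using this)
  simp only [ofReal_zero, zero_mul, add_zero, smul_eq_mul] at hrect
  have b1 : ‖∫ x : ℝ in (-R)..R, Q (x + R * I)‖ ≤ ε / 8 / R * |R - -R| := by
    refine norm_integral_le_of_norm_le_const fun x _ => key _ (by simp [hR0.le]) ?_
    have := abs_im_le_norm ((x : ℂ) + R * I)
    simpa [abs_of_pos hR0] using this
  have b2 : ‖∫ y : ℝ in (0)..R, Q (R + y * I)‖ ≤ ε / 8 / R * |R - 0| := by
    refine norm_integral_le_of_norm_le_const fun y hy => key _ ?_ ?_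
    · rw [Set.uIoc_of_le hR0.le] at hy
      simp [hy.1.le]
    · have := abs_re_le_norm ((R : ℂ) + y * I)
      simpa [abs_of_pos hR0] using this
  have b3 : ‖∫ y : ℝ in (0)..R, Q ((-R : ℝ) + y * I)‖ ≤ ε / 8 / R * |R - 0| := by
    refine norm_integral_le_of_norm_le_const fun y hy => key _ ?_ ?_
    · rw [Set.uIoc_of_le hR0.le] at hy
      simp [hy.1.le]
    · have := abs_re_le_norm (((-R : ℝ) : ℂ) + y * I)
      simpa [abs_of_pos hR0] using this
  have e : (∫ t : ℝ in (-R)..R, Q t) = (∫ x : ℝ in (-R)..R, Q (x + R * I))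
      - I * (∫ y : ℝ in (0)..R, Q (R + y * I))
      + I * (∫ y : ℝ in (0)..R, Q ((-R : ℝ) + y * I)) := by
    linear_combination hrect
  rw [dist_zero_right, e]
  refine (norm_add_le _ _).trans_lt ?_
  refine (add_le_add_left (norm_sub_le _ _) _).trans_lt ?_
  rw [norm_mul, norm_mul, norm_I, one_mul, one_mul]
  have e1 : ε / 8 / R * |R - -R| = ε / 4 := by
    rw [sub_neg_eq_add, abs_of_pos (by linarith)]; field_simp; ring
  have e2 : ε / 8 / R * |R - 0| = ε / 8 := by
    rw [sub_zero, abs_of_pos hR0]; field_simp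
  linarith

theorem tendsto_integral_inv_sub_mul_sub_conj {z : ℂ} (hz : 0 < z.im) :
    Tendsto (fun R : ℝ => ∫ t in (-R)..R, (z - conj z) / (((t : ℂ) - z) * (t - conj z))) atTop
      (𝓝 (2 * π * I)) := by
  have hne : ∀ t : ℝ, (t - z.re) ^ 2 + z.im ^ 2 ≠ 0 := fun t => by positivity
  have hker : ∀ t : ℝ, (z - conj z) / (((t : ℂ) - z) * (t - conj z))
      = 2 * I * ((z.im / ((t - z.re) ^ 2 + z.im ^ 2) : ℝ) : ℂ) := by
    intro t
    have h1 : ((t : ℂ) - z) * (t - conj z) = (((t - z.re) ^ 2 + z.im ^ 2 : ℝ) : ℂ) := by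
      apply Complex.ext <;> simp [pow_two]
      ring
    have h2 : z - conj z = 2 * I * (z.im : ℂ) := by
      apply Complex.ext <;> simp ; ring
    rw [h1, h2]; push_cast; ring
  have hint : ∀ R : ℝ, (∫ t in (-R)..R, z.im / ((t - z.re) ^ 2 + z.im ^ 2))
      = Real.arctan ((R - z.re) / z.im) - Real.arctan ((-R - z.re) / z.im) := by
    intro R
    refine integral_eq_sub_of_hasDerivAt (f := fun t => Real.arctan ((t - z.re) / z.im)) ?_ ?_
    · intro t _
      have := ((((hasDerivAt_id t).sub_const z.re).div_const z.im)).arctan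
      convert! this using 1
      have := hne t
      have h3 : z.im ^ 2 + (t - z.re) ^ 2 ≠ 0 := by rwa [add_comm]
      simp only [id]
      field_simp
      ring
    · exact (Continuous.div continuous_const (by fun_prop) hne).intervalIntegrable _ _
  simp_rw [hker, intervalIntegral.integral_const_mul, intervalIntegral.integral_ofReal, hint]
  have t1 : Tendsto (fun R : ℝ => Real.arctan ((R - z.re) / z.im)) atTop (𝓝 (π / 2)) :=
    (tendsto_nhds_of_tendsto_nhdsWithin Real.tendsto_arctan_atTop).comp
      ((tendsto_atTop_add_const_right _ _ tendsto_id).atTop_div_const hz)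
  have t2 : Tendsto (fun R : ℝ => Real.arctan ((-R - z.re) / z.im)) atTop (𝓝 (-(π / 2))) :=
    (tendsto_nhds_of_tendsto_nhdsWithin Real.tendsto_arctan_atBot).comp
      ((tendsto_atBot_add_const_right _ _ tendsto_neg_atTop_atBot).atBot_div_const hz)
  have t3 := ((continuous_ofReal.tendsto _).comp (t1.sub t2)).const_mul (2 * I)
  convert! t3 using 2
  push_cast; ring

/-- A function holomorphic on the upper half-plane, continuous up to the boundary and vanishing at
infinity is the Cauchy transform of its imaginary part on the real line. -/
theorem eq_integral_im_boundary_of_upperHalfPlane {F : ℂ → ℂ}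
    (hc : ContinuousOn F {w | 0 ≤ w.im})
    (hd : ∀ w : ℂ, 0 < w.im → DifferentiableAt ℂ F w)
    (hlim : Tendsto F (Bornology.cobounded ℂ ⊓ 𝓟 {w | 0 ≤ w.im}) (𝓝 0))
    {b c : ℝ} (hb : ∀ t : ℝ, t ≤ b → (F t).im = 0) (hc' : ∀ t : ℝ, c ≤ t → (F t).im = 0)
    {z : ℂ} (hz : 0 < z.im) :
    F z = 1 / π * ∫ t in b..c, ((F t).im : ℂ) / (t - z) := by
  set l := Bornology.cobounded ℂ ⊓ 𝓟 {w : ℂ | 0 ≤ w.im}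
  have hinv : ∀ c : ℂ, Tendsto (fun w : ℂ => (w - c)⁻¹) l (𝓝 0) := fun c =>
    (tendsto_inv₀_cobounded.comp (tendsto_sub_const_cobounded c)).mono_left inf_le_left
  have hne : ∀ c : ℂ, ∀ᶠ w in l, w ≠ c := fun c =>
    (Bornology.eventually_ne_cobounded c).filter_mono inf_le_left
  have hquot : ∀ c : ℂ, Tendsto (fun w : ℂ => w * (w - c)⁻¹) l (𝓝 1) := by
    intro c
    have h := ((hinv c).const_mul c).const_add 1
    rw [mul_zero, add_zero] at h
    refine h.congr' ?_
    filter_upwards [hne c] with w hw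
    have := sub_ne_zero.2 hw
    field_simp
    ring
  have hzbar : ∀ w : ℂ, 0 ≤ w.im → w - conj z ≠ 0 := by
    intro w hw h
    have := congrArg Complex.im h
    simp at this
    linarith
  have hzt : ∀ t : ℝ, (t : ℂ) - z ≠ 0 := by
    intro t h
    have := congrArg Complex.im h
    simp at this
    linarith
  have hFt : Continuous fun t : ℝ => F t :=
    hc.comp_continuous continuous_ofReal (by simp)
  -- the integral against the reflected pole vanishes
  have hreflected : Tendsto (fun R : ℝ => ∫ t in (-R)..R, F t * ((t : ℂ) - conj z)⁻¹) atTop (𝓝 0) := by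
    refine tendsto_integral_boundary_of_upperHalfPlane
      (Q := fun w => F w * (w - conj z)⁻¹) Set.countable_empty ?_ ?_ ?_
    · exact hc.mul ((by fun_prop : ContinuousOn (fun w : ℂ => w - conj z) _).inv₀ hzbar)
    · intro w hw _
      exact (hd w hw).mul ((by fun_prop : DifferentiableAt ℂ (fun w : ℂ => w - conj z) w).inv
        (hzbar w hw.le))
    · have := hlim.mul (hquot (conj z))
      rw [zero_mul] at this
      refine this.congr fun w => by ring
  -- the Cauchy formula, with the pole at `z` compensated at `conj z`
  set Φ : ℂ → ℂ := fun w => F w - F z * (z - conj z) * (w - conj z)⁻¹ with hΦ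
  have hΦz : Φ z = 0 := by
    have := hzbar z hz.le
    simp only [hΦ]
    field_simp
    ring
  have hΦc : ContinuousOn Φ {w | 0 ≤ w.im} :=
    hc.sub (continuousOn_const.mul
      ((by fun_prop : ContinuousOn (fun w : ℂ => w - conj z) _).inv₀ hzbar))
  have hΦd : ∀ w : ℂ, 0 < w.im → DifferentiableAt ℂ Φ w := fun w hw =>
    (hd w hw).sub ((differentiableAt_const _).mul
      ((by fun_prop : DifferentiableAt ℂ (fun w : ℂ => w - conj z) w).inv (hzbar w hw.le)))
  have hΦlim : Tendsto Φ l (𝓝 0) := by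
    have := hlim.sub ((hinv (conj z)).const_mul (F z * (z - conj z)))
    simpa using this
  have hnhds : {w : ℂ | 0 ≤ w.im} ∈ 𝓝 z :=
    mem_of_superset ((isOpen_lt continuous_const continuous_im).mem_nhds hz)
      fun w (hw : 0 < w.im) => hw.le
  have hds : ∀ w, w ≠ z → dslope Φ z w = Φ w * (w - z)⁻¹ := by
    intro w hw
    rw [dslope_of_ne _ hw, slope_def_field, hΦz, sub_zero, div_eq_mul_inv]
  have hcompensated : Tendsto (fun R : ℝ => ∫ t in (-R)..R, Φ t * ((t : ℂ) - z)⁻¹) atTop (𝓝 0) := by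
    have := tendsto_integral_boundary_of_upperHalfPlane (Q := dslope Φ z)
      (Set.countable_singleton z) ((continuousOn_dslope hnhds).2 ⟨hΦc, hΦd z hz⟩) ?_ ?_
    · refine this.congr fun R => integral_congr fun t _ => hds _ (sub_ne_zero.1 (hzt t))
    · intro w hw hwz
      exact (differentiableAt_dslope_of_ne hwz).2 (hΦd w hw)
    · have h := hΦlim.mul (hquot z)
      rw [zero_mul] at h
      refine h.congr' ?_
      filter_upwards [hne z] with w hw
      rw [hds w hw]; ring
  have hcauchy : Tendsto (fun R : ℝ => ∫ t in (-R)..R, F t * ((t : ℂ) - z)⁻¹) atTop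
      (𝓝 (F z * (2 * π * I))) := by
    have h := hcompensated.add ((tendsto_integral_inv_sub_mul_sub_conj hz).const_mul (F z))
    rw [zero_add] at h
    refine h.congr fun R => ?_
    rw [← intervalIntegral.integral_const_mul, ← intervalIntegral.integral_add]
    · refine integral_congr fun t _ => ?_
      simp only [hΦ, div_eq_mul_inv, mul_inv]
      ring
    · refine Continuous.intervalIntegrable ?_ _ _
      exact (hΦc.comp_continuous continuous_ofReal (by simp)).mul
        ((by fun_prop : Continuous fun t : ℝ => (t : ℂ) - z).inv₀ hzt)
    · refine Continuous.intervalIntegrable (continuous_const.mul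
        (Continuous.div continuous_const (by fun_prop) ?_)) _ _
      exact fun t => mul_ne_zero (hzt t) (hzbar t (by simp))
  have hconj : Tendsto (fun R : ℝ => ∫ t in (-R)..R, conj (F t) * ((t : ℂ) - z)⁻¹) atTop (𝓝 0) := by
    have h := (continuous_conj.tendsto _).comp hreflected
    rw [map_zero] at h
    refine h.congr fun R => ?_
    simp only [Function.comp, intervalIntegral_eq_integral_uIoc, Complex.real_smul, map_mul,
      Complex.conj_ofReal, ← integral_conj]
    simp
  have hI : ∀ u v : ℝ, IntervalIntegrable (fun t : ℝ => ((F t).im : ℂ) / (t - z))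
      MeasureTheory.volume u v := fun u v =>
    (Continuous.div (continuous_ofReal.comp (continuous_im.comp hFt)) (by fun_prop)
      hzt).intervalIntegrable _ _
  have hdiff := hcauchy.sub hconj
  rw [sub_zero] at hdiff
  have hev : ∀ᶠ R : ℝ in atTop, (∫ t in (-R)..R, F t * ((t : ℂ) - z)⁻¹)
      - (∫ t in (-R)..R, conj (F t) * ((t : ℂ) - z)⁻¹)
      = 2 * I * ∫ t in b..c, ((F t).im : ℂ) / (t - z) := by
    filter_upwards [eventually_ge_atTop |b|, eventually_ge_atTop |c|] with R hRb hRc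
    have hcont : Continuous fun t : ℝ => ((t : ℂ) - z)⁻¹ :=
      (by fun_prop : Continuous fun t : ℝ => (t : ℂ) - z).inv₀ hzt
    have hFc : Continuous fun t : ℝ => F t * ((t : ℂ) - z)⁻¹ := hFt.mul hcont
    have hFc' : Continuous fun t : ℝ => conj (F t) * ((t : ℂ) - z)⁻¹ :=
      (continuous_conj.comp hFt).mul hcont
    rw [← intervalIntegral.integral_sub (hFc.intervalIntegrable _ _)
      (hFc'.intervalIntegrable _ _)]
    have h1 : (∫ t in (-R)..R, (F t * ((t : ℂ) - z)⁻¹ - conj (F t) * ((t : ℂ) - z)⁻¹))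
        = 2 * I * ∫ t in (-R)..R, ((F t).im : ℂ) / (t - z) := by
      rw [← intervalIntegral.integral_const_mul]
      refine integral_congr fun t _ => ?_
      have : F t - conj (F t) = 2 * I * ((F t).im : ℂ) := by
        apply Complex.ext <;> simp ; ring
      rw [← sub_mul, this]; ring
    have hl0 : (∫ t in (-R)..b, ((F t).im : ℂ) / (t - z)) = 0 := by
      rw [integral_congr (g := fun _ => (0 : ℂ)), intervalIntegral.integral_zero]
      intro t ht
      rw [Set.uIcc_of_le (neg_le_of_abs_le hRb)] at ht
      simp [hb t ht.2]
    have hr0 : (∫ t in c..R, ((F t).im : ℂ) / (t - z)) = 0 := by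
      rw [integral_congr (g := fun _ => (0 : ℂ)), intervalIntegral.integral_zero]
      intro t ht
      rw [Set.uIcc_of_le (le_of_abs_le hRc)] at ht
      simp [hc' t ht.1]
    rw [h1, ← integral_add_adjacent_intervals (hI (-R) b) (hI b R),
      ← integral_add_adjacent_intervals (hI b c) (hI c R), hl0, hr0, zero_add, add_zero]
  have := tendsto_nhds_unique (hdiff.congr' hev) tendsto_const_nhds
  have hpi : (π : ℂ) ≠ 0 := by exact_mod_cast Real.pi_ne_zero
  have h2 : (2 * I) * (F z * π - ∫ t in b..c, ((F t).im : ℂ) / (t - z)) = 0 := by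
    linear_combination this
  have h3 := (mul_eq_zero.1 h2).resolve_left (by simp)
  rw [← sub_eq_zero.1 h3]
  field_simp

theorem continuousOn_cpow_const_upperHalfPlane {c : ℂ} (hc : 0 < c.re) :
    ContinuousOn (fun w : ℂ => w ^ c) {w | 0 ≤ w.im} := by
  intro w hw
  by_cases h : 0 ≤ w.re ∨ w.im ≠ 0
  · exact (continuousAt_cpow_const_of_re_pos h hc).continuousWithinAt
  · push Not at h
    have hlog := ((continuousWithinAt_log_of_re_neg_of_im_zero h.1 h.2).mul_const c).cexp
    have hw0 : w ≠ 0 := by rintro rfl; simp at h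
    refine hlog.congr_of_eventuallyEq ?_ (cpow_def_of_ne_zero hw0 c)
    filter_upwards [mem_nhdsWithin_of_mem_nhds (isOpen_ne.mem_nhds hw0)] with v hv
    exact cpow_def_of_ne_zero hv c

theorem ofReal_add_cpow_of_lt_norm {a : ℝ} (ha : 0 ≤ a) {w : ℂ} (hw : 0 ≤ w.im) (haw : a < ‖w‖)
    (c : ℂ) : (a + w) ^ c = w ^ c * exp (log (1 + a * w⁻¹) * c) := by
  have hw0 : w ≠ 0 := norm_pos_iff.1 (ha.trans_lt haw)
  have hlt : ‖(a : ℂ) * w⁻¹‖ < 1 := by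
    rw [norm_mul, norm_inv, norm_real, Real.norm_of_nonneg ha, ← div_eq_mul_inv,
      div_lt_one (norm_pos_iff.2 hw0)]
    exact haw
  have hre : 0 < (1 + (a : ℂ) * w⁻¹).re := by
    have := (abs_lt.1 ((abs_re_le_norm _).trans_lt hlt)).1
    rw [add_re, one_re]
    linarith
  have him : (1 + (a : ℂ) * w⁻¹).im ≤ 0 := by
    rw [add_im, one_im, im_ofReal_mul, inv_im, zero_add, neg_div, mul_neg, neg_nonpos]
    exact mul_nonneg ha (div_nonneg hw (normSq_nonneg w))
  have h0 : 1 + (a : ℂ) * w⁻¹ ≠ 0 := fun h => by simp [h] at hre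
  have harg : arg (1 + (a : ℂ) * w⁻¹) ≤ 0 := by
    rcases him.lt_or_eq with h | h
    · exact (arg_neg_iff.2 h).le
    · exact (arg_eq_zero_iff.2 ⟨hre.le, h⟩).le
  have hmul : (a : ℂ) + w = w * (1 + a * w⁻¹) := by field_simp; ring
  have hlog : log (w * (1 + a * w⁻¹)) = log w + log (1 + a * w⁻¹) := by
    refine log_mul hw0 h0 ⟨?_, ?_⟩
    · have := arg_nonneg_iff.2 hw
      have := neg_pi_lt_arg (1 + (a : ℂ) * w⁻¹)
      linarith
    · have := arg_le_pi w
      linarith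
  rw [hmul, cpow_def_of_ne_zero (mul_ne_zero hw0 h0), hlog, add_mul, Complex.exp_add,
    cpow_def_of_ne_zero hw0]

theorem tendsto_prod_cpow_sub_sub_mean {n : ℕ} (hn : n ≠ 0) {a : ℕ → ℝ}
    (ha : ∀ k ∈ Finset.Icc 1 n, 0 ≤ a k) :
    Tendsto (fun w : ℂ => ∏ k ∈ Finset.Icc 1 n, ((a k : ℂ) + w) ^ (1 / (n : ℂ)) - w
        - (∑ k ∈ Finset.Icc 1 n, (a k : ℂ)) / n)
      (Bornology.cobounded ℂ ⊓ 𝓟 {w | 0 ≤ w.im}) (𝓝 0) := by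
  set g : ℂ → ℂ := fun ζ => exp (∑ k ∈ Finset.Icc 1 n, log (1 + a k * ζ) * (1 / (n : ℂ))) with hg
  have hder : HasDerivAt g ((∑ k ∈ Finset.Icc 1 n, (a k : ℂ)) / n) 0 := by
    have h1 : ∀ k ∈ Finset.Icc 1 n,
        HasDerivAt (fun ζ : ℂ => log (1 + a k * ζ) * (1 / (n : ℂ))) (a k * (1 / (n : ℂ))) 0 := by
      intro k _
      have h := (((hasDerivAt_id (0 : ℂ)).const_mul (a k : ℂ)).const_add 1).clog
        (by simp)
      simpa using h.mul_const (1 / (n : ℂ))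
    have h2 := (HasDerivAt.fun_sum h1).cexp
    convert! h2 using 1
    simp [← Finset.sum_mul, div_eq_mul_inv]
  have hg0 : g 0 = 1 := by simp [hg]
  have hslope := (hasDerivAt_iff_tendsto_slope.1 hder).comp (tendsto_inv₀_cobounded' (α := ℂ))
  have h3 := (hslope.mono_left (inf_le_left (b := 𝓟 {w : ℂ | 0 ≤ w.im}))).sub_const
    ((∑ k ∈ Finset.Icc 1 n, (a k : ℂ)) / n)
  rw [sub_self] at h3
  refine h3.congr' ?_
  have hlarge : ∀ᶠ w : ℂ in Bornology.cobounded ℂ, ∀ k ∈ Finset.Icc 1 n, a k < ‖w‖ :=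
    (Finset.eventually_all _).2 fun k _ => tendsto_norm_cobounded_atTop.eventually_gt_atTop _
  rw [EventuallyEq, eventually_inf_principal]
  filter_upwards [hlarge, Bornology.eventually_ne_cobounded 0] with w hw hw0 him
  have hprod : ∏ k ∈ Finset.Icc 1 n, ((a k : ℂ) + w) ^ (1 / (n : ℂ)) = w * g w⁻¹ := by
    rw [Finset.prod_congr rfl fun k hk => ofReal_add_cpow_of_lt_norm (ha k hk) him (hw k hk) _,
      Finset.prod_mul_distrib, ← Complex.exp_sum, Finset.prod_const, Nat.card_Icc, Nat.add_sub_cancel,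
      one_div, cpow_nat_inv_pow _ hn]
    simp only [hg, one_div]
  rw [hprod, Function.comp, slope_def_field, hg0, sub_zero, div_inv_eq_mul]
  ring

theorem prod_ofReal_sub_cpow {n ℓ : ℕ} (hℓ : ℓ ≤ n) {a : ℕ → ℝ} {s : ℝ}
    (hle : ∀ k ∈ Finset.Icc 1 ℓ, a k ≤ s) (hge : ∀ k ∈ Finset.Icc (ℓ + 1) n, s ≤ a k) :
    ∏ k ∈ Finset.Icc 1 n, ((a k : ℂ) + (-s : ℝ)) ^ (1 / (n : ℂ))
      = (((∏ k ∈ Finset.Icc 1 n, |a k - s|) ^ ((1 : ℝ) / n) : ℝ) : ℂ)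
        * exp ((ℓ * π / n : ℝ) * I) := by
  have hfac : ∀ k ∈ Finset.Icc 1 n, ((a k : ℂ) + (-s : ℝ)) ^ (1 / (n : ℂ))
      = ((|a k - s| ^ ((1 : ℝ) / n) : ℝ) : ℂ) * if k ≤ ℓ then exp (π * I * (1 / n)) else 1 := by
    intro k hk
    rw [Finset.mem_Icc] at hk
    have hsub : (a k : ℂ) + (-s : ℝ) = (a k - s : ℝ) := by push_cast; ring
    rw [hsub, ofReal_cpow (abs_nonneg _)]
    push_cast
    split_ifs with h
    · have h1 : a k - s ≤ 0 := sub_nonpos.2 (hle k (Finset.mem_Icc.2 ⟨hk.1, h⟩))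
      have h2 := ofReal_cpow_of_nonpos h1 (1 / n)
      rw [abs_of_nonpos h1]
      push_cast at h2 ⊢
      exact h2
    · have h1 : 0 ≤ a k - s := sub_nonneg.2 (hge k (Finset.mem_Icc.2 ⟨by omega, hk.2⟩))
      rw [abs_of_nonneg h1, mul_one]
      push_cast
      rfl
  have hfilter : (Finset.Icc 1 n).filter (· ≤ ℓ) = Finset.Icc 1 ℓ := by
    ext k
    simp only [Finset.mem_filter, Finset.mem_Icc]
    omega
  rw [Finset.prod_congr rfl hfac, Finset.prod_mul_distrib, Finset.prod_ite, hfilter,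
    Finset.prod_const_one, mul_one, Finset.prod_const, Nat.card_Icc, Nat.add_sub_cancel,
    ← Complex.exp_nat_mul, ← ofReal_prod,
    Real.finsetProd_rpow _ _ fun k _ => abs_nonneg _]
  congr 2
  push_cast
  ring

theorem im_prod_ofReal_sub_cpow {n ℓ : ℕ} (hℓ : ℓ ≤ n) {a : ℕ → ℝ} {s : ℝ}
    (hle : ∀ k ∈ Finset.Icc 1 ℓ, a k ≤ s) (hge : ∀ k ∈ Finset.Icc (ℓ + 1) n, s ≤ a k) :
    (∏ k ∈ Finset.Icc 1 n, ((a k : ℂ) + (-s : ℝ)) ^ (1 / (n : ℂ))).im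
      = Real.sin (ℓ * π / n) * (∏ k ∈ Finset.Icc 1 n, |a k - s|) ^ ((1 : ℝ) / n) := by
  rw [prod_ofReal_sub_cpow hℓ hle hge, im_ofReal_mul, exp_ofReal_mul_I_im, mul_comm]

theorem geometric_mean_integral_representation_of_im_pos
    {n : ℕ} (hn : 1 ≤ n) {a : ℕ → ℝ} (hpos : ∀ k ∈ Finset.Icc 1 n, 0 < a k)
    (hmono : MonotoneOn a (Set.Icc 1 n)) {z : ℂ} (hz : 0 < z.im) :
    Complex.exp ((1 / (n : ℂ)) *
        ∑ k ∈ Finset.Icc 1 n, Complex.log (((a k : ℝ) : ℂ) + z))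
      = (((∑ k ∈ Finset.Icc 1 n, a k) / n : ℝ) : ℂ) + z
        - (1 / (Real.pi : ℂ)) *
          ∑ ℓ ∈ Finset.Icc 1 (n - 1),
            ((Real.sin (ℓ * Real.pi / n) : ℝ) : ℂ) *
              ∫ t in (a ℓ)..(a (ℓ + 1)),
                (((∏ k ∈ Finset.Icc 1 n, |a k - t|) ^ ((1 : ℝ) / n) : ℝ) : ℂ) /
                  ((t : ℂ) + z) := by
  have hn0 : n ≠ 0 := by omega
  have hnpos : 0 < (1 / (n : ℂ)).re := by
    have : (1 / (n : ℂ)) = ((1 / n : ℝ) : ℂ) := by push_cast; rfl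
    rw [this, ofReal_re]
    positivity
  have hsplit : ∀ {w : ℂ}, 0 < w.im → ∀ k, (a k : ℂ) + w ∈ slitPlane := fun hw k =>
    Or.inr (by simpa using hw.ne')
  set F : ℂ → ℂ := fun w => ∏ k ∈ Finset.Icc 1 n, ((a k : ℂ) + w) ^ (1 / (n : ℂ)) - w
        - (∑ k ∈ Finset.Icc 1 n, (a k : ℂ)) / n with hF
  have hFc : ContinuousOn F {w | 0 ≤ w.im} := by
    refine ((continuousOn_finsetProd _ fun k _ => ?_).sub continuousOn_id).sub continuousOn_const
    exact (continuousOn_cpow_const_upperHalfPlane hnpos).comp (by fun_prop)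
      fun w (hw : 0 ≤ w.im) => by simpa using hw
  have hFd : ∀ w : ℂ, 0 < w.im → DifferentiableAt ℂ F w := by
    intro w hw
    refine ((DifferentiableAt.fun_finsetProd fun k _ => ?_).sub differentiableAt_id).sub_const _
    exact ((differentiableAt_id.const_add _).cpow_const (hsplit hw k))
  have hFim : ∀ s : ℝ, ∀ ℓ ≤ n, (∀ k ∈ Finset.Icc 1 ℓ, a k ≤ s) →
      (∀ k ∈ Finset.Icc (ℓ + 1) n, s ≤ a k) → (F (-s : ℝ)).im
        = Real.sin (ℓ * π / n) * (∏ k ∈ Finset.Icc 1 n, |a k - s|) ^ ((1 : ℝ) / n) := by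
    intro s ℓ hℓ hle hge
    have him : ((∑ k ∈ Finset.Icc 1 n, (a k : ℂ)) / n).im = 0 := by
      rw [← ofReal_sum, ← ofReal_natCast, ← ofReal_div, ofReal_im]
    simp only [hF]
    rw [sub_im, sub_im, him, im_prod_ofReal_sub_cpow hℓ hle hge, ofReal_im, sub_zero, sub_zero]
  have hmono' : ∀ {i j : ℕ}, 1 ≤ i → i ≤ j → j ≤ n → a i ≤ a j := fun hi hij hj =>
    hmono ⟨hi, hij.trans hj⟩ ⟨hi.trans hij, hj⟩ hij
  have hb : ∀ t : ℝ, t ≤ -a n → (F t).im = 0 := by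
    intro t ht
    have h := hFim (-t) n le_rfl (fun k hk => ?_) (fun k hk => ?_)
    · rw [neg_neg] at h
      rw [h, mul_div_cancel_left₀ _ (by exact_mod_cast hn0), Real.sin_pi, zero_mul]
    · rw [Finset.mem_Icc] at hk
      linarith [hmono' hk.1 hk.2 le_rfl]
    · rw [Finset.mem_Icc] at hk
      omega
  have hc : ∀ t : ℝ, -a 1 ≤ t → (F t).im = 0 := by
    intro t ht
    have h := hFim (-t) 0 (Nat.zero_le _) (fun k hk => ?_) (fun k hk => ?_)
    · rw [neg_neg] at h
      simp [h]
    · rw [Finset.mem_Icc] at hk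
      omega
    · rw [Finset.mem_Icc] at hk
      linarith [hmono' le_rfl hk.1 hk.2]
  have hz0 : ∀ s : ℝ, (s : ℂ) + z ≠ 0 := fun s h => by
    have := congrArg Complex.im h
    simp at this
    linarith
  have hFcont : Continuous fun s : ℝ => F (-s : ℝ) :=
    hFc.comp_continuous (by fun_prop) (by simp)
  have hint : Continuous fun s : ℝ => ((F (-s : ℝ)).im : ℂ) / ((s : ℂ) + z) :=
    (continuous_ofReal.comp (continuous_im.comp hFcont)).div (by fun_prop) hz0
  have hmain := eq_integral_im_boundary_of_upperHalfPlane hFc hFd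
    (tendsto_prod_cpow_sub_sub_mean hn0 fun k hk => (hpos k hk).le) hb hc hz
  rw [← integral_comp_neg (fun t : ℝ => ((F t).im : ℂ) / (t - z))] at hmain
  have hneg : (∫ s in (a 1)..(a n), ((F (-s : ℝ)).im : ℂ) / ((-s : ℝ) - z))
      = -∫ s in (a 1)..(a n), ((F (-s : ℝ)).im : ℂ) / ((s : ℂ) + z) := by
    rw [← intervalIntegral.integral_neg]
    refine integral_congr fun s _ => ?_
    rw [← div_neg]
    push_cast
    ring
  have hIcc : Finset.Icc 1 (n - 1) = Finset.Ico 1 n := by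
    ext k
    simp only [Finset.mem_Icc, Finset.mem_Ico]
    omega
  rw [hneg, ← sum_integral_adjacent_intervals_Ico hn
    (fun k _ => hint.intervalIntegrable _ _)] at hmain
  have hsum : ∑ ℓ ∈ Finset.Ico 1 n,
        ∫ s in (a ℓ)..(a (ℓ + 1)), ((F (-s : ℝ)).im : ℂ) / ((s : ℂ) + z)
      = ∑ ℓ ∈ Finset.Icc 1 (n - 1), ((Real.sin (ℓ * π / n) : ℝ) : ℂ) *
          ∫ t in (a ℓ)..(a (ℓ + 1)),
            (((∏ k ∈ Finset.Icc 1 n, |a k - t|) ^ ((1 : ℝ) / n) : ℝ) : ℂ) / ((t : ℂ) + z) := by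
    rw [hIcc]
    refine Finset.sum_congr rfl fun ℓ hℓ => ?_
    rw [Finset.mem_Ico] at hℓ
    rw [← intervalIntegral.integral_const_mul]
    refine integral_congr fun s hs => ?_
    rw [Set.uIcc_of_le (hmono' hℓ.1 (Nat.le_succ ℓ) hℓ.2)] at hs
    rw [hFim s ℓ hℓ.2.le, ofReal_mul, mul_div_assoc]
    · intro k hk
      rw [Finset.mem_Icc] at hk
      exact (hmono' hk.1 hk.2 hℓ.2.le).trans hs.1
    · intro k hk
      rw [Finset.mem_Icc] at hk
      exact hs.2.trans (hmono' (by omega) hk.1 hk.2)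
  rw [hsum] at hmain
  have hexp : Complex.exp ((1 / (n : ℂ)) * ∑ k ∈ Finset.Icc 1 n, Complex.log ((a k : ℂ) + z))
      = ∏ k ∈ Finset.Icc 1 n, ((a k : ℂ) + z) ^ (1 / (n : ℂ)) := by
    rw [Finset.mul_sum, Complex.exp_sum]
    refine Finset.prod_congr rfl fun k _ => ?_
    rw [cpow_def_of_ne_zero (hz0 _), mul_comm]
  rw [hexp]
  simp only [hF] at hmain
  rw [ofReal_div, ofReal_sum, ofReal_natCast]
  linear_combination hmain

theorem geometric_mean_integral_representation
    (n : ℕ) (hn : 1 ≤ n) (a : ℕ → ℝ)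
    (hpos : ∀ k ∈ Finset.Icc 1 n, 0 < a k)
    (hmono : ∀ k ∈ Finset.Icc 1 (n - 1), a k ≤ a (k + 1))
    (z : ℂ) (hz : ((a 1 : ℝ) : ℂ) + z ∈ Complex.slitPlane) :
    Complex.exp ((1 / (n : ℂ)) *
        ∑ k ∈ Finset.Icc 1 n, Complex.log (((a k : ℝ) : ℂ) + z))
      = (((∑ k ∈ Finset.Icc 1 n, a k) / n : ℝ) : ℂ) + z
        - (1 / (Real.pi : ℂ)) *
          ∑ ℓ ∈ Finset.Icc 1 (n - 1),
            ((Real.sin (ℓ * Real.pi / n) : ℝ) : ℂ) *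
              ∫ t in (a ℓ)..(a (ℓ + 1)),
                (((∏ k ∈ Finset.Icc 1 n, |a k - t|) ^ ((1 : ℝ) / n) : ℝ) : ℂ) /
                  ((t : ℂ) + z) := by
  have hmon : MonotoneOn a (Set.Icc 1 n) := by
    intro i hi j hj hij
    obtain ⟨hi1, -⟩ := hi
    obtain ⟨-, hjn⟩ := hj
    induction j, hij using Nat.le_induction with
    | base => exact le_rfl
    | succ j hij ih =>
      exact (ih (by omega)).trans (hmono j (Finset.mem_Icc.2 ⟨by omega, by omega⟩))
  rcases lt_trichotomy z.im 0 with him | him | him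
  · have h := congrArg conj (geometric_mean_integral_representation_of_im_pos hn hpos hmon
      (z := conj z) (by simpa using him))
    have hlog : ∀ k, conj (log ((a k : ℂ) + conj z)) = log ((a k : ℂ) + z) := by
      intro k
      rw [← log_conj, map_add, conj_conj, conj_ofReal]
      rw [Ne, arg_eq_pi_iff]
      simp [him.ne]
    have hI : ∀ (u v : ℝ) (g : ℝ → ℝ), conj (∫ t in u..v, (g t : ℂ) / ((t : ℂ) + conj z))
        = ∫ t in u..v, (g t : ℂ) / ((t : ℂ) + z) := by
      intro u v g
      simp only [intervalIntegral_eq_integral_uIoc, Complex.real_smul, map_mul, conj_ofReal,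
        ← integral_conj]
      simp
    rw [← exp_conj] at h
    simpa only [map_mul, map_sub, map_add, map_sum, map_div₀, map_one, map_natCast, conj_ofReal,
      conj_conj, hlog, hI] using h
  · have hre : 0 < a 1 + z.re := by
      rcases hz with h | h
      · simpa using h
      · simp [him] at h
    have hge : ∀ k ∈ Finset.Icc 1 n, a 1 ≤ a k := fun k hk => by
      rw [Finset.mem_Icc] at hk
      exact hmon ⟨le_rfl, hn⟩ hk hk.1
    have hpath : Tendsto (fun ε : ℝ => z + ε * I) (𝓝[>] 0) (𝓝 z) := by
      have : Continuous fun ε : ℝ => z + ε * I := by fun_prop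
      have h := this.tendsto 0
      simp only [ofReal_zero, zero_mul, add_zero] at h
      exact h.mono_left nhdsWithin_le_nhds
    have hL : Tendsto (fun ε : ℝ => Complex.exp ((1 / (n : ℂ)) *
        ∑ k ∈ Finset.Icc 1 n, Complex.log ((a k : ℂ) + (z + ε * I)))) (𝓝[>] 0)
        (𝓝 (Complex.exp ((1 / (n : ℂ)) * ∑ k ∈ Finset.Icc 1 n, Complex.log ((a k : ℂ) + z)))) := by
      refine ((tendsto_finsetSum _ fun k hk => ?_).const_mul _).cexp
      refine (hpath.const_add _).clog (Or.inl ?_)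
      simp only [add_re, ofReal_re]
      linarith [hge k hk]
    have hR : ∀ ℓ ∈ Finset.Icc 1 (n - 1), Tendsto (fun ε : ℝ => ∫ t in (a ℓ)..(a (ℓ + 1)),
        (((∏ k ∈ Finset.Icc 1 n, |a k - t|) ^ ((1 : ℝ) / n) : ℝ) : ℂ) / ((t : ℂ) + (z + ε * I)))
        (𝓝[>] 0) (𝓝 (∫ t in (a ℓ)..(a (ℓ + 1)),
        (((∏ k ∈ Finset.Icc 1 n, |a k - t|) ^ ((1 : ℝ) / n) : ℝ) : ℂ) / ((t : ℂ) + z))) := by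
      intro ℓ hℓ
      have hg : Continuous fun t : ℝ => (∏ k ∈ Finset.Icc 1 n, |a k - t|) ^ ((1 : ℝ) / n) :=
        Continuous.rpow_const (by fun_prop) fun _ => Or.inr (by positivity)
      have hpos' : ∀ t ∈ Set.uIoc (a ℓ) (a (ℓ + 1)), a 1 + z.re ≤ t + z.re := by
        intro t ht
        rw [Finset.mem_Icc] at hℓ
        rw [Set.uIoc_of_le (hmono ℓ (Finset.mem_Icc.2 hℓ))] at ht
        linarith [ht.1, hge ℓ (Finset.mem_Icc.2 ⟨hℓ.1, by omega⟩)]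
      refine intervalIntegral.tendsto_integral_filter_of_dominated_convergence
        (fun t => (∏ k ∈ Finset.Icc 1 n, |a k - t|) ^ ((1 : ℝ) / n) / (a 1 + z.re)) ?_ ?_ ?_ ?_
      · refine Eventually.of_forall fun ε => Measurable.aestronglyMeasurable ?_
        exact (continuous_ofReal.comp hg).measurable.div (by fun_prop)
      · refine Eventually.of_forall fun ε => Eventually.of_forall fun t ht => ?_
        have hnn : 0 ≤ (∏ k ∈ Finset.Icc 1 n, |a k - t|) ^ ((1 : ℝ) / n) := by positivity
        rw [norm_div, norm_real, Real.norm_of_nonneg hnn]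
        refine div_le_div_of_nonneg_left hnn hre ((hpos' t ht).trans ?_)
        have := re_le_norm ((t : ℂ) + (z + ε * I))
        simpa using this
      · exact (hg.div_const _).intervalIntegrable _ _
      · refine Eventually.of_forall fun t ht => ?_
        refine tendsto_const_nhds.div (hpath.const_add _) fun h => ?_
        have := congrArg Complex.re h
        simp only [add_re, ofReal_re, zero_re] at this
        linarith [hpos' t ht]
    have hRHS := (hpath.const_add (((∑ k ∈ Finset.Icc 1 n, a k) / n : ℝ) : ℂ)).sub
      ((tendsto_finsetSum (Finset.Icc 1 (n - 1)) fun ℓ hℓ =>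
        (hR ℓ hℓ).const_mul ((Real.sin (ℓ * Real.pi / n) : ℝ) : ℂ)).const_mul (1 / (Real.pi : ℂ)))
    refine tendsto_nhds_unique hL (hRHS.congr' ?_)
    filter_upwards [self_mem_nhdsWithin] with ε hε
    exact (geometric_mean_integral_representation_of_im_pos hn hpos hmon
      (by simpa [him] using hε)).symm
  · exact geometric_mean_integral_representation_of_im_pos hn hpos hmon him
end

section
/- Let 0 < a_1 ≤ a_2 ≤ ... ≤ a_n and let x > 0 be real. Then (∏_{k=1}^n (a_k + x))^{1/n} = A_n(a) + x - (1/π)∑_{ℓ=1}^{n-1} sin(ℓπ/n) ∫_{a_ℓ}^{a_{ℓ+1}} (∏_{k=1}^n |a_k - t|)^{1/n} · dt/(t + x), where A_n(a) = (1/n)∑_{k=1}^n a_k and all roots are real positive n-th roots. -/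
open Finset Filter Real intervalIntegral

open Asymptotics Bornology Topology

theorem isBigO_inv_add_const_cobounded (b : ℂ) :
    (fun z : ℂ ↦ (z + b)⁻¹) =O[cobounded ℂ] fun z ↦ z⁻¹ := by
  refine IsBigO.of_bound 2 ?_
  filter_upwards [tendsto_norm_cobounded_atTop.eventually_ge_atTop (2 * ‖b‖ + 1)] with z hz
  have h : ‖z‖ - ‖b‖ ≤ ‖z + b‖ := by simpa using norm_sub_norm_le z (-b)
  have hb := norm_nonneg b
  rw [norm_inv, norm_inv, ← div_eq_mul_inv, inv_eq_one_div, div_le_div_iff₀] <;> linarith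

/-- A function that is holomorphic in the open upper half-plane, continuous up to the real axis and
`O(z⁻²)` at infinity has vanishing symmetric integrals over the real axis in the limit. -/
theorem tendsto_integral_symm_of_isBigO_inv_sq {k : ℂ → ℂ}
    (hc : ∀ z : ℂ, 0 ≤ z.im → ContinuousAt k z)
    (hd : ∀ z : ℂ, 0 < z.im → DifferentiableAt ℂ k z)
    (hO : k =O[cobounded ℂ] fun z ↦ z⁻¹ * z⁻¹) :
    Tendsto (fun R : ℝ ↦ ∫ s in -R..R, k s) atTop (𝓝 0) := by
  obtain ⟨C, hC0, hC⟩ := hO.exists_pos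
  rw [isBigOWith_iff] at hC
  obtain ⟨R₀, hR₀⟩ : ∃ R₀ : ℝ, ∀ z : ℂ, R₀ ≤ ‖z‖ → ‖k z‖ ≤ C * ‖z⁻¹ * z⁻¹‖ := by
    rw [← comap_norm_atTop, eventually_comap] at hC
    obtain ⟨R₀, h⟩ := eventually_atTop.1 hC
    exact ⟨R₀, fun z hz ↦ h _ hz z rfl⟩
  have hlim : Tendsto (fun R : ℝ ↦ 4 * C * R⁻¹) atTop (𝓝 0) := by
    simpa using tendsto_inv_atTop_zero.const_mul (4 * C)
  refine squeeze_zero_norm' ?_ hlim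
  filter_upwards [eventually_ge_atTop R₀, eventually_gt_atTop 0] with R hR hR0
  have hb : ∀ z : ℂ, R ≤ ‖z‖ → ‖k z‖ ≤ C * R⁻¹ ^ 2 := by
    intro z hz
    refine (hR₀ z (hR.trans hz)).trans ?_
    rw [norm_mul, norm_inv, ← sq]
    gcongr
  have key := Complex.integral_boundary_rect_eq_zero_of_continuousOn_of_differentiableOn k
    (-R : ℝ) ((R : ℝ) + (R : ℝ) * Complex.I) (fun z hz ↦ by
      refine (hc z ?_).continuousWithinAt
      have := hz.2
      simp [Set.uIcc_of_le hR0.le] at this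
      exact this.1) (fun z hz ↦ by
      refine (hd z ?_).differentiableWithinAt
      have := hz.2
      simp [hR0.le] at this
      exact this.1)
  simp only [Complex.ofReal_re, Complex.ofReal_im, Complex.add_re, Complex.mul_re, Complex.I_re,
    mul_zero, Complex.I_im, sub_zero, add_zero, Complex.ofReal_zero, zero_mul, Complex.add_im,
    Complex.mul_im, mul_one, zero_add, smul_eq_mul] at key
  have h1 : ‖∫ s in -R..R, k (s + R * Complex.I)‖ ≤ C * R⁻¹ ^ 2 * |R - -R| :=
    norm_integral_le_of_norm_le_const fun s _ ↦ hb _ <| by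
      simpa [abs_of_pos hR0] using Complex.abs_im_le_norm (s + R * Complex.I)
  have h2 : ‖∫ s in (0 : ℝ)..R, k (R + s * Complex.I)‖ ≤ C * R⁻¹ ^ 2 * |R - 0| :=
    norm_integral_le_of_norm_le_const fun s _ ↦ hb _ <| by
      simpa [abs_of_pos hR0] using Complex.abs_re_le_norm (R + s * Complex.I)
  have h3 : ‖∫ s in (0 : ℝ)..R, k ((-R : ℝ) + s * Complex.I)‖ ≤ C * R⁻¹ ^ 2 * |R - 0| :=
    norm_integral_le_of_norm_le_const fun s _ ↦ hb _ <| by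
      simpa [abs_of_pos hR0] using Complex.abs_re_le_norm ((-R : ℝ) + s * Complex.I)
  rw [abs_of_pos (by linarith)] at h1 h2 h3
  have e : ∫ s in -R..R, k s = (∫ s in -R..R, k (s + R * Complex.I))
      - Complex.I * (∫ s in (0 : ℝ)..R, k (R + s * Complex.I))
      + Complex.I * ∫ s in (0 : ℝ)..R, k ((-R : ℝ) + s * Complex.I) := by
    linear_combination key
  rw [e]
  refine (norm_add_le _ _).trans <| (add_le_add_left (norm_sub_le _ _) _).trans ?_
  rw [norm_mul, norm_mul, Complex.norm_I, one_mul, one_mul]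
  refine (add_le_add (add_le_add h1 h2) h3).trans (le_of_eq ?_)
  field_simp
  ring

namespace Complex

theorem add_I_ne_zero_of_im_nonneg {z : ℂ} (hz : 0 ≤ z.im) : z + I ≠ 0 := by
  intro h
  have := congrArg im h
  simp at this
  linarith

theorem re_nonneg_or_im_ne_zero_div_add_I (a : ℝ) {z : ℂ} (hz : 0 ≤ z.im) :
    0 ≤ ((z + a) / (z + I)).re ∨ ((z + a) / (z + I)).im ≠ 0 := by
  have hN : 0 < normSq (z + I) := normSq_pos.2 (add_I_ne_zero_of_im_nonneg hz)
  rw [or_iff_not_imp_right, not_not, div_im, div_re, ← sub_div, ← add_div, div_eq_zero_iff]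
  rintro (h | h)
  · refine div_nonneg ?_ hN.le
    simp at h ⊢
    have hp : z.re = -((z.im + 1) * a) := by linarith
    rw [hp]
    have : 0 ≤ z.im * (z.im + 1) * (a ^ 2 + 1) := by positivity
    linarith
  · exact absurd h hN.ne'

theorem div_add_I_mem_slitPlane {a : ℝ} {z : ℂ} (hz : 0 ≤ z.im) (hza : z + a ≠ 0) :
    (z + a) / (z + I) ∈ slitPlane := by
  rw [mem_slitPlane_iff]
  rcases re_nonneg_or_im_ne_zero_div_add_I a hz with h | h
  · rcases h.lt_or_eq with h' | h'
    · exact Or.inl h'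
    · refine Or.inr fun h0 ↦ div_ne_zero hza (add_I_ne_zero_of_im_nonneg hz) ?_
      exact Complex.ext h'.symm h0
  · exact Or.inr h

/-- The geometric mean of the functions `z + a k`, `k ∈ s`, as a holomorphic function in the upper
half-plane. -/
noncomputable def geomMean {ι : Type*} (s : Finset ι) (a : ι → ℝ) (z : ℂ) : ℂ :=
  (z + I) * ∏ k ∈ s, ((z + a k) / (z + I)) ^ (#s : ℂ)⁻¹

variable {ι : Type*} {s : Finset ι} {a : ι → ℝ}

theorem continuousAt_geomMean (hs : s.Nonempty) {z : ℂ} (hz : 0 ≤ z.im) :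
    ContinuousAt (geomMean s a) z := by
  have h0 := add_I_ne_zero_of_im_nonneg hz
  have hs' : 0 < (#s : ℝ) := by exact_mod_cast hs.card_pos
  refine ContinuousAt.mul (by fun_prop) (tendsto_finsetProd s fun k _ ↦ ?_)
  refine ContinuousAt.comp (g := fun w : ℂ ↦ w ^ (#s : ℂ)⁻¹)
    (continuousAt_cpow_const_of_re_pos (re_nonneg_or_im_ne_zero_div_add_I (a k) hz) ?_)
    (by fun_prop (disch := assumption))
  rw [← ofReal_natCast, ← ofReal_inv, ofReal_re]
  positivity

theorem differentiableAt_geomMean {z : ℂ} (hz : 0 ≤ z.im) (hza : ∀ k ∈ s, z + a k ≠ 0) :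
    DifferentiableAt ℂ (geomMean s a) z := by
  have h0 := add_I_ne_zero_of_im_nonneg hz
  refine DifferentiableAt.mul (by fun_prop) (DifferentiableAt.fun_finsetProd fun k hk ↦ ?_)
  exact DifferentiableAt.cpow_const (by fun_prop (disch := assumption))
    (div_add_I_mem_slitPlane hz (hza k hk))

theorem geomMean_isBigO (hs : s.Nonempty) :
    (fun z ↦ geomMean s a z - z - ((∑ k ∈ s, a k) / #s : ℝ)) =O[cobounded ℂ] fun z ↦ z⁻¹ := by
  classical
  have hs' : (#s : ℂ) ≠ 0 := by exact_mod_cast hs.card_pos.ne'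
  set F : ℂ → ℂ := fun w ↦ ∏ k ∈ s, (1 + (a k - I) * w) ^ (#s : ℂ)⁻¹ with hF
  have hF0 : F 0 = 1 := by simp [hF]
  have hdF : HasDerivAt F ((∑ k ∈ s, a k) / #s - I) 0 := by
    have : ∀ k ∈ s, HasDerivAt (fun w : ℂ ↦ (1 + (a k - I) * w) ^ (#s : ℂ)⁻¹)
        ((#s : ℂ)⁻¹ * (a k - I)) 0 := by
      intro k _
      have h1 : HasDerivAt (fun w : ℂ ↦ 1 + (a k - I) * w) (a k - I) 0 := by
        simpa using ((hasDerivAt_id (0 : ℂ)).const_mul (a k - I)).const_add 1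
      simpa using h1.cpow_const (c := (#s : ℂ)⁻¹) (by simp)
    refine (HasDerivAt.fun_finsetProd this).congr_deriv ?_
    simp [← Finset.mul_sum, Finset.sum_sub_distrib]
    field_simp
  have hev : ∀ᶠ w in 𝓝 (0 : ℂ), DifferentiableAt ℂ F w := by
    have : ∀ᶠ w in 𝓝 (0 : ℂ), ∀ k ∈ s, 1 + (a k - I) * w ∈ slitPlane := by
      rw [Filter.eventually_all_finset]
      intro k _
      refine ContinuousAt.eventually_mem (f := fun w : ℂ ↦ 1 + (a k - I) * w) (by fun_prop) ?_
      exact isOpen_slitPlane.mem_nhds (by simp)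
    filter_upwards [this] with w hw
    exact DifferentiableAt.fun_finsetProd fun k hk ↦
      DifferentiableAt.cpow_const (by fun_prop) (hw k hk)
  have hds : DifferentiableAt ℂ (dslope F 0) 0 := by
    have h1 : DifferentiableOn ℂ F {w | DifferentiableAt ℂ F w} :=
      fun w hw ↦ DifferentiableAt.differentiableWithinAt hw
    exact ((differentiableOn_dslope hev).2 h1).differentiableAt hev
  have hO := hds.isBigO_sub
  rw [dslope_same, hdF.deriv] at hO
  have hw : Tendsto (fun z : ℂ ↦ (z + I)⁻¹) (cobounded ℂ) (𝓝 0) :=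
    (isBigO_inv_add_const_cobounded I).trans_tendsto tendsto_inv₀_cobounded
  refine ((hO.comp_tendsto hw).congr' ?_ ?_).trans (isBigO_inv_add_const_cobounded I)
  · filter_upwards [tendsto_norm_cobounded_atTop.eventually_gt_atTop 1] with z hz
    have h0 : z + I ≠ 0 := by
      intro h
      rw [eq_neg_of_add_eq_zero_left h] at hz
      simp at hz
    have hFz : F (z + I)⁻¹ = ∏ k ∈ s, ((z + a k) / (z + I)) ^ (#s : ℂ)⁻¹ := by
      refine Finset.prod_congr rfl fun k _ ↦ ?_
      congr 1
      field_simp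
      ring
    rw [Function.comp_apply, dslope_of_ne _ (inv_ne_zero h0), slope_def_field, hF0, hFz, geomMean]
    push_cast
    field_simp
    ring
  · exact Eventually.of_forall fun z ↦ by simp

theorem div_add_I_cpow (y b : ℝ) {r : ℝ} (hr : r ≠ 0) :
    ((y : ℂ) / (b + I)) ^ (r : ℂ) =
      (|y| ^ r : ℝ) * (if y < 0 then exp (π * r * I) else 1) * (b + I)⁻¹ ^ (r : ℂ) := by
  have h0 : (b : ℂ) + I ≠ 0 := add_I_ne_zero_of_im_nonneg (by simp)
  have hr' : (r : ℂ) ≠ 0 := by exact_mod_cast hr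
  rcases eq_or_ne y 0 with rfl | hy
  · simp [hr', Real.zero_rpow hr]
  have hy' : 0 < |y| := abs_pos.2 hy
  have habs : ((|y| ^ r : ℝ) : ℂ) = exp (Real.log |y| * r) := by
    rw [ofReal_cpow hy'.le, cpow_def_of_ne_zero (by exact_mod_cast hy'.ne'), ofReal_log hy'.le]
  rw [habs, cpow_def_of_ne_zero (inv_ne_zero h0)]
  split_ifs with h
  · have e : (y : ℂ) / (b + I) = (|y| : ℝ) * -(b + I)⁻¹ := by
      rw [abs_of_neg h]
      push_cast
      ring
    have hlog : log (-((b : ℂ) + I)⁻¹) = log ((b : ℂ) + I)⁻¹ + π * I := by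
      have him : (((b : ℂ) + I)⁻¹).im < 0 := by
        rw [inv_im]
        refine div_neg_of_neg_of_pos (by simp) (normSq_pos.2 h0)
      rw [log, log, arg_neg_eq_arg_add_pi_of_im_neg him, norm_neg]
      push_cast
      ring
    rw [e, cpow_def_of_ne_zero (by simp [hy, h0]), log_ofReal_mul hy' (by simp [h0]), hlog,
      ← exp_add, ← exp_add]
    congr 1
    ring
  · have e : (y : ℂ) / (b + I) = (|y| : ℝ) * (b + I)⁻¹ := by
      rw [abs_of_nonneg (not_lt.1 h), div_eq_mul_inv]
    rw [e, cpow_def_of_ne_zero (by simp [hy, h0]), log_ofReal_mul hy' (by simp [h0]), mul_one,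
      ← exp_add]
    congr 1
    ring

theorem geomMean_ofReal (hs : s.Nonempty) (b : ℝ) :
    geomMean s a b = ((∏ k ∈ s, |b + a k|) ^ ((1 : ℝ) / #s) : ℝ) *
      exp ((#{k ∈ s | b + a k < 0} * π / #s : ℝ) * I) := by
  have hs' : (#s : ℝ) ≠ 0 := by exact_mod_cast hs.card_pos.ne'
  have h0 : (b : ℂ) + I ≠ 0 := add_I_ne_zero_of_im_nonneg (by simp)
  have h1 : ∀ k ∈ s, (((b : ℂ) + a k) / (b + I)) ^ (#s : ℂ)⁻¹ =
      (|b + a k| ^ ((1 : ℝ) / #s) : ℝ) *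
        (if b + a k < 0 then exp (π * ((1 : ℝ) / #s : ℝ) * I) else 1) *
        (b + I)⁻¹ ^ (#s : ℂ)⁻¹ := by
    intro k _
    rw [← ofReal_add, ← one_div, ← ofReal_natCast, ← ofReal_one, ← ofReal_div,
      div_add_I_cpow _ _ (one_div_ne_zero hs'), ofReal_one]
  rw [geomMean, Finset.prod_congr rfl h1, Finset.prod_mul_distrib, Finset.prod_mul_distrib,
    Finset.prod_const, cpow_nat_inv_pow _ hs.card_pos.ne', Finset.prod_ite, Finset.prod_const,
    Finset.prod_const_one, mul_one, ← ofReal_prod,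
    Real.finsetProd_rpow _ _ fun k _ ↦ abs_nonneg _, ← exp_nat_mul]
  field_simp
  congr 2
  push_cast
  ring

theorem geomMean_ofReal_im (hs : s.Nonempty) (b : ℝ) :
    (geomMean s a b).im = Real.sin (#{k ∈ s | b + a k < 0} * π / #s) *
      (∏ k ∈ s, |b + a k|) ^ ((1 : ℝ) / #s) := by
  rw [geomMean_ofReal hs, im_ofReal_mul, exp_ofReal_mul_I_im, mul_comm]

theorem geomMean_ofReal_of_nonneg (hs : s.Nonempty) {b : ℝ} (hb : ∀ k ∈ s, 0 ≤ b + a k) :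
    geomMean s a b = ((∏ k ∈ s, (b + a k)) ^ ((1 : ℝ) / #s) : ℝ) := by
  rw [geomMean_ofReal hs, Finset.filter_false_of_mem fun k hk ↦ not_lt.2 (hb k hk),
    Finset.prod_congr rfl fun k hk ↦ abs_of_nonneg (hb k hk)]
  simp

end Complex

namespace Complex

variable {ι : Type*} {s : Finset ι} {a : ι → ℝ}

theorem continuousAt_dslope_geomMean (hs : s.Nonempty) {x : ℝ} (hx : ∀ k ∈ s, 0 < x + a k) {z : ℂ}
    (hz : 0 ≤ z.im) : ContinuousAt (dslope (geomMean s a) x) z := by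
  rcases eq_or_ne z x with rfl | h
  · refine continuousAt_dslope_same.2 (differentiableAt_geomMean hz fun k hk ↦ ?_)
    exact_mod_cast (hx k hk).ne'
  · exact (continuousAt_dslope_of_ne h).2 (continuousAt_geomMean hs hz)

theorem continuous_im_dslope_geomMean (hs : s.Nonempty) {x : ℝ} (hx : ∀ k ∈ s, 0 < x + a k) :
    Continuous fun t : ℝ ↦ (dslope (geomMean s a) x t).im :=
  continuous_im.comp <| continuous_iff_continuousAt.2 fun t ↦
    (continuousAt_dslope_geomMean hs hx (z := t) (by simp)).comp continuous_ofReal.continuousAt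

theorem dslope_geomMean_im (hs : s.Nonempty) {x : ℝ} (hx : ∀ k ∈ s, 0 < x + a k) {t : ℝ}
    (ht : t ≠ x) : (dslope (geomMean s a) x t).im = Real.sin (#{k ∈ s | t + a k < 0} * π / #s) *
      ((∏ k ∈ s, |t + a k|) ^ ((1 : ℝ) / #s) / (t - x)) := by
  rw [dslope_of_ne _ (by exact_mod_cast ht), slope_def_field, ← ofReal_sub, div_ofReal_im, sub_im,
    geomMean_ofReal_of_nonneg hs fun k hk ↦ (hx k hk).le, ofReal_im, sub_zero,
    geomMean_ofReal_im hs, mul_div_assoc]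

theorem tendsto_integral_im_dslope_geomMean (hs : s.Nonempty) {x : ℝ}
    (hx : ∀ k ∈ s, 0 < x + a k) :
    Tendsto (fun R : ℝ ↦ ∫ t in -R..R, (dslope (geomMean s a) x t).im) atTop
      (𝓝 (π * ((∏ k ∈ s, (x + a k)) ^ ((1 : ℝ) / #s) - (x + (∑ k ∈ s, a k) / #s)))) := by
  set A : ℝ := (∑ k ∈ s, a k) / #s with hA
  set G : ℝ := (∏ k ∈ s, (x + a k)) ^ ((1 : ℝ) / #s)
  have hfx : geomMean s a x = G := geomMean_ofReal_of_nonneg hs fun k hk ↦ (hx k hk).le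
  set f := geomMean s a with hf
  set c : ℝ := x + A - G with hcdef
  set k : ℂ → ℂ := fun z ↦ dslope f x z - 1 - c * (z + I)⁻¹ with hk
  have hkc : ∀ z : ℂ, 0 ≤ z.im → ContinuousAt k z := fun z hz ↦ by
    have h0 := add_I_ne_zero_of_im_nonneg hz
    exact ((continuousAt_dslope_geomMean hs hx hz).sub continuousAt_const).sub
      (by fun_prop (disch := assumption))
  have hkd : ∀ z : ℂ, 0 < z.im → DifferentiableAt ℂ k z := fun z hz ↦ by
    have h0 := add_I_ne_zero_of_im_nonneg hz.le
    have hne (y : ℝ) : z ≠ y := by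
      rintro rfl
      simp at hz
    have hfd : DifferentiableAt ℂ f z := differentiableAt_geomMean hz.le fun j _ h ↦
      hne (-a j) (by simpa using eq_neg_of_add_eq_zero_left h)
    exact (((differentiableAt_dslope_of_ne (hne x)).2 hfd).sub_const 1).sub
      (by fun_prop (disch := assumption))
  have hkO : k =O[cobounded ℂ] fun z ↦ z⁻¹ * z⁻¹ := by
    have h1 : (fun z : ℂ ↦ (z + (-x : ℝ))⁻¹) =O[cobounded ℂ] fun z ↦ z⁻¹ :=
      isBigO_inv_add_const_cobounded _
    have h2 := isBigO_inv_add_const_cobounded I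
    refine (((geomMean_isBigO (a := a) hs).mul h1).add
      ((h1.mul h2).const_mul_left (c * (I + x)))).congr' ?_ EventuallyEq.rfl
    filter_upwards [tendsto_norm_cobounded_atTop.eventually_gt_atTop 1,
      tendsto_norm_cobounded_atTop.eventually_gt_atTop ‖(x : ℂ)‖] with z hz hzx
    have h0 : z + I ≠ 0 := by
      intro h
      rw [eq_neg_of_add_eq_zero_left h] at hz
      simp at hz
    have hne : z ≠ x := by
      rintro rfl
      exact lt_irrefl _ hzx
    have h3 : z - x ≠ 0 := sub_ne_zero.2 hne
    simp only [hk]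
    rw [dslope_of_ne _ hne, slope_def_field, hfx, ofReal_neg, ← sub_eq_add_neg, ← hA, ← hf]
    have hcc : (c : ℂ) = x + A - G := by
      rw [hcdef]
      push_cast
      ring
    field_simp
    rw [hcc]
    ring
  have hk_lim := tendsto_integral_symm_of_isBigO_inv_sq hkc hkd hkO
  have hkcont : Continuous fun t : ℝ ↦ k t := continuous_iff_continuousAt.2 fun t ↦
    (hkc t (by simp)).comp continuous_ofReal.continuousAt
  have him : ∀ R : ℝ, ∫ t in -R..R, (dslope f x t).im =
      (∫ t in -R..R, k t).im - c * (Real.arctan R - Real.arctan (-R)) := by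
    intro R
    have h1 : (∫ t in -R..R, k t).im = ∫ t in -R..R, (k t).im :=
      (intervalIntegral_im (𝕜 := ℂ) (hkcont.intervalIntegrable (-R) R)).symm
    have h2 : ∀ t : ℝ, (k t).im = (dslope f x t).im + c * (1 + t ^ 2)⁻¹ := by
      intro t
      simp [hk, inv_im, normSq_apply]
      rw [sq, neg_div, mul_neg, sub_neg_eq_add, one_div, add_comm 1]
    have h3 : Continuous fun t : ℝ ↦ c * (1 + t ^ 2)⁻¹ :=
      continuous_const.mul <| Continuous.inv₀ (by fun_prop) fun t ↦ by positivity
    simp_rw [h1, h2]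
    rw [integral_add ((continuous_im_dslope_geomMean hs hx).intervalIntegrable _ _)
      (h3.intervalIntegrable _ _), integral_const_mul, integral_inv_one_add_sq]
    ring
  have harc : Tendsto Real.arctan atTop (𝓝 (π / 2)) :=
    tendsto_nhds_of_tendsto_nhdsWithin tendsto_arctan_atTop
  simp_rw [him, Real.arctan_neg]
  have hval : π * (G - (x + A)) = (0 : ℂ).im - c * (π / 2 - -(π / 2)) := by
    rw [zero_im, hcdef]
    ring
  rw [hval]
  exact ((continuous_im.tendsto 0).comp hk_lim).sub ((harc.sub harc.neg).const_mul c)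

end Complex

theorem geometric_mean_integral_representation_real
    (n : ℕ) (hn : 1 ≤ n) (a : ℕ → ℝ)
    (hpos : ∀ k ∈ Finset.Icc 1 n, 0 < a k)
    (hmono : ∀ k ∈ Finset.Icc 1 (n - 1), a k ≤ a (k + 1))
    (x : ℝ) (hx : 0 < x) :
    (∏ k ∈ Finset.Icc 1 n, (a k + x)) ^ ((1 : ℝ) / n)
      = (∑ k ∈ Finset.Icc 1 n, a k) / n + x
        - (1 / Real.pi) *
          ∑ ℓ ∈ Finset.Icc 1 (n - 1),
            Real.sin (ℓ * Real.pi / n) *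
              ∫ t in (a ℓ)..(a (ℓ + 1)),
                (∏ k ∈ Finset.Icc 1 n, |a k - t|) ^ ((1 : ℝ) / n) / (t + x) := by
  have hs : (Finset.Icc 1 n).Nonempty := Finset.nonempty_Icc.2 hn
  have hcard : #(Finset.Icc 1 n) = n := by simp
  have hn0 : (n : ℝ) ≠ 0 := by positivity
  have hxa : ∀ k ∈ Finset.Icc 1 n, 0 < x + a k := fun k hk ↦ add_pos hx (hpos k hk)
  have hmono' : MonotoneOn a (Set.Icc 1 n) := by
    refine monotoneOn_of_le_add_one Set.ordConnected_Icc fun k _ hk hk' ↦ hmono k ?_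
    simp only [Set.mem_Icc, Finset.mem_Icc] at *
    omega
  set J : ℝ → ℝ := fun t ↦ (dslope (Complex.geomMean (Finset.Icc 1 n) a) x t).im with hJ
  have hJc : Continuous J := Complex.continuous_im_dslope_geomMean hs hxa
  have hJi : ∀ u v, IntervalIntegrable (fun t ↦ J (-t)) MeasureTheory.volume u v := fun u v ↦
    (hJc.comp continuous_neg).intervalIntegrable u v
  have hJt : ∀ t, t ≠ -x → J (-t) = Real.sin (#{k ∈ Finset.Icc 1 n | a k < t} * π / n) *
      -((∏ k ∈ Finset.Icc 1 n, |a k - t|) ^ ((1 : ℝ) / n) / (t + x)) := by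
    intro t ht
    have h := Complex.dslope_geomMean_im hs hxa (t := -t) fun h ↦ ht (by linarith)
    simp only [hJ, h, hcard, neg_add_eq_sub, sub_neg]
    rw [← div_neg]
    congr 2
    ring
  have hzero : ∀ u v, (∀ t ∈ Set.uIoc u v, Real.sin (#{k ∈ Finset.Icc 1 n | a k < t} * π / n) = 0) →
      ∫ t in u..v, J (-t) = 0 := by
    intro u v h
    rw [integral_congr_ae (g := fun _ ↦ 0), integral_zero]
    filter_upwards [MeasureTheory.Measure.ae_ne MeasureTheory.volume (-x)] with t ht htu
    rw [hJt t ht, h t htu, zero_mul]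
  have hmid : ∫ t in a 1..a n, J (-t) = -∑ ℓ ∈ Finset.Icc 1 (n - 1), Real.sin (ℓ * π / n) *
      ∫ t in (a ℓ)..(a (ℓ + 1)),
        (∏ k ∈ Finset.Icc 1 n, |a k - t|) ^ ((1 : ℝ) / n) / (t + x) := by
    rw [← sum_integral_adjacent_intervals_Ico hn fun k _ ↦ hJi _ _, ← Finset.sum_neg_distrib]
    refine Finset.sum_congr (by ext; simp; omega) fun ℓ hℓ ↦ ?_
    rw [← integral_const_mul, ← integral_neg]
    refine integral_congr_ae (Eventually.of_forall fun t ht ↦ ?_)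
    rw [Set.uIoc_of_le (hmono ℓ hℓ)] at ht
    have hℓ' := Finset.mem_Icc.1 hℓ
    have hℓ0 := hpos ℓ (Finset.mem_Icc.2 (by omega))
    have hf : ({k ∈ Finset.Icc 1 n | a k < t} : Finset ℕ) = Finset.Icc 1 ℓ := by
      ext k
      simp only [Finset.mem_filter, Finset.mem_Icc]
      refine ⟨fun ⟨hk, hkt⟩ ↦ ⟨hk.1, ?_⟩, fun hk ↦ ⟨by omega, ?_⟩⟩
      · by_contra! hlt
        have := hmono' (a := ℓ + 1) (b := k) ⟨by omega, by omega⟩ hk hlt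
        linarith [ht.2]
      · exact (hmono' ⟨hk.1, by omega⟩ ⟨by omega, by omega⟩ hk.2).trans_lt ht.1
    rw [hJt t (by linarith [ht.1]), hf]
    simp
  have hlim := Complex.tendsto_integral_im_dslope_geomMean hs hxa
  have hconst : (fun R : ℝ ↦ ∫ t in -R..R, J t) =ᶠ[atTop] fun _ ↦ ∫ t in a 1..a n, J (-t) := by
    filter_upwards [eventually_ge_atTop (-a 1), eventually_ge_atTop (a n)] with R h1 h2
    have hneg := integral_comp_neg (a := -R) (b := R) J
    rw [neg_neg] at hneg
    rw [← hneg, ← integral_add_adjacent_intervals (hJi (-R) (a 1)) (hJi (a 1) R),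
      ← integral_add_adjacent_intervals (hJi (a 1) (a n)) (hJi (a n) R),
      hzero (-R) (a 1), hzero (a n) R, zero_add, add_zero]
    · intro t ht
      rw [Set.uIoc_of_le h2] at ht
      rw [Finset.filter_true_of_mem, hcard, mul_div_cancel_left₀ _ hn0, Real.sin_pi]
      intro k hk
      have hk' := Finset.mem_Icc.1 hk
      exact (hmono' hk' ⟨hn, le_rfl⟩ hk'.2).trans_lt ht.1
    · intro t ht
      rw [Set.uIoc_of_le (by linarith)] at ht
      rw [Finset.filter_false_of_mem]
      · simp
      intro k hk
      have hk' := Finset.mem_Icc.1 hk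
      exact not_lt.2 (ht.2.trans (hmono' ⟨le_rfl, hn⟩ hk' hk'.1))
  have heq := tendsto_nhds_unique (tendsto_const_nhds.congr' hconst.symm) hlim
  rw [hmid, hcard] at heq
  simp_rw [add_comm x] at heq
  have hpi := Real.pi_ne_zero
  generalize ∑ ℓ ∈ Finset.Icc 1 (n - 1), Real.sin (ℓ * π / n) *
    ∫ t in (a ℓ)..(a (ℓ + 1)),
      (∏ k ∈ Finset.Icc 1 n, |a k - t|) ^ ((1 : ℝ) / n) / (t + x) = S at heq ⊢
  field_simp at heq ⊢
  linear_combination -heq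
end

section
/- Let 0 < a_1 ≤ a_2 ≤ ... ≤ a_n. Then G_n(a) = A_n(a) - (1/π)∑_{ℓ=1}^{n-1} sin(ℓπ/n) ∫_{a_ℓ}^{a_{ℓ+1}} (∏_{k=1}^n |a_k - t|)^{1/n} · dt/t, where G_n(a) = (∏_{k=1}^n a_k)^{1/n} and A_n(a) = (1/n)∑_{k=1}^n a_k. -/
open Finset Filter Real intervalIntegral

open scoped Topology

/-- Cauchy's theorem for the closed upper half-plane, for functions that are `o(1 / z)` at infinity. -/
theorem tendsto_integral_symm_of_upperHalfPlane_decay {h : ℂ → ℂ}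
    (hc : ContinuousOn h {z | 0 ≤ z.im}) (hd : DifferentiableOn ℂ h {z | 0 < z.im})
    (hlim : Tendsto (fun z => z * h z) (Bornology.cobounded ℂ ⊓ 𝓟 {z | 0 ≤ z.im}) (𝓝 0)) :
    Tendsto (fun R : ℝ => ∫ x in (-R)..R, h x) atTop (𝓝 0) := by
  rw [Metric.tendsto_nhds]
  intro ε hε
  have hev := (Metric.tendsto_nhds.1 hlim) (ε / 8) (by positivity)
  rw [eventually_inf_principal, hasBasis_cobounded_norm.eventually_iff] at hev
  obtain ⟨R₀, -, hR₀⟩ := hev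
  filter_upwards [eventually_ge_atTop R₀, eventually_gt_atTop 0] with R hR hRpos
  have bound : ∀ z : ℂ, R ≤ ‖z‖ → 0 ≤ z.im → ‖h z‖ ≤ ε / 8 / R := by
    intro z hz hzi
    have h1 := hR₀ (show R₀ ≤ ‖z‖ by linarith) hzi
    rw [dist_zero_right, norm_mul] at h1
    rw [le_div_iff₀ hRpos]
    nlinarith [norm_nonneg (h z)]
  have hrect := Complex.integral_boundary_rect_eq_zero_of_continuousOn_of_differentiableOn h
    ⟨-R, 0⟩ ⟨R, R⟩ (hc.mono ?_) (hd.mono ?_)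
  · simp only [Complex.ofReal_zero, zero_mul, add_zero] at hrect
    have top : ‖∫ x in (-R)..R, h (x + R * Complex.I)‖ ≤ ε / 8 / R * |R - -R| := by
      refine norm_integral_le_of_norm_le_const fun x _ => bound _ ?_ (by simp [hRpos.le])
      have := Complex.abs_im_le_norm (x + R * Complex.I)
      simpa [abs_of_pos hRpos] using this
    have side : ∀ r : ℝ, |r| = R →
        ‖Complex.I • ∫ y in (0 : ℝ)..R, h (r + y * Complex.I)‖ ≤ ε / 8 / R * |R - 0| := by
      intro r hr
      rw [norm_smul, Complex.norm_I, one_mul]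
      refine norm_integral_le_of_norm_le_const fun y hy => bound _ ?_ ?_
      · have := Complex.abs_re_le_norm (r + y * Complex.I)
        simpa [hr] using this
      · rw [Set.uIoc_of_le hRpos.le] at hy
        simpa using hy.1.le
    have right := side R (abs_of_pos hRpos)
    have left := side (-R) (by rw [abs_neg, abs_of_pos hRpos])
    rw [show |R - -R| = 2 * R by rw [abs_of_pos] <;> linarith,
      show ε / 8 / R * (2 * R) = ε / 4 by field_simp; norm_num] at top
    rw [sub_zero, abs_of_pos hRpos, show ε / 8 / R * R = ε / 8 by field_simp] at left right
    rw [dist_zero_right]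
    have key : ∫ x in (-R)..R, h x = (∫ x in (-R)..R, h (x + R * Complex.I))
        - Complex.I • (∫ y in (0 : ℝ)..R, h (R + y * Complex.I))
        + Complex.I • ∫ y in (0 : ℝ)..R, h ((-R : ℝ) + y * Complex.I) := by
      linear_combination hrect
    rw [key]
    refine (norm_add_le _ _).trans_lt ?_
    have := norm_sub_le (∫ x in (-R)..R, h (x + R * Complex.I))
      (Complex.I • (∫ y in (0 : ℝ)..R, h (R + y * Complex.I)))
    linarith
  · intro z hz
    have := hz.2
    simp only [Set.uIcc_of_le hRpos.le] at this
    exact this.1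
  · intro z hz
    have := hz.2
    simp only [min_eq_left hRpos.le] at this
    exact this.1

/-- A positive real power is continuous on the closed upper half-plane. -/
theorem continuousOn_cpow_const_im_nonneg {c : ℝ} (hc : 0 < c) :
    ContinuousOn (fun z : ℂ => z ^ (c : ℂ)) {z | 0 ≤ z.im} := by
  intro z hz
  by_cases hs : z ∈ Complex.slitPlane
  · exact (continuousAt_cpow_const hs).continuousWithinAt
  by_cases h0 : z = 0
  · subst h0
    have h1 := Complex.continuousAt_cpow_zero_of_re_pos (z := (c : ℂ)) (by simpa using hc)
    exact (ContinuousAt.comp (f := fun z : ℂ => (z, (c : ℂ))) h1 (by fun_prop)).continuousWithinAt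
  · rw [Complex.mem_slitPlane_iff, not_or, not_lt, not_not] at hs
    have hre : z.re < 0 := lt_of_le_of_ne hs.1 fun h => h0 (Complex.ext h hs.2)
    have hlog := Complex.continuousWithinAt_log_of_re_neg_of_im_zero hre hs.2
    refine ((hlog.mul_const (c : ℂ)).cexp).congr_of_eventuallyEq ?_
      (Complex.cpow_def_of_ne_zero h0 _)
    filter_upwards [mem_nhdsWithin_of_mem_nhds (isOpen_ne.mem_nhds h0)] with w hw
    exact Complex.cpow_def_of_ne_zero hw _

section shiftedGeomMean

variable {ι : Type*} {s : Finset ι} {a : ι → ℝ}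

/-- The geometric mean of the numbers `z + a k`, with principal roots. -/
noncomputable def shiftedGeomMean (s : Finset ι) (a : ι → ℝ) (z : ℂ) : ℂ :=
  ∏ k ∈ s, (z + a k) ^ (((1 : ℝ) / #s : ℝ) : ℂ)

theorem continuousOn_shiftedGeomMean (hs : s.Nonempty) :
    ContinuousOn (shiftedGeomMean s a) {z | 0 ≤ z.im} := by
  refine continuousOn_finsetProd _ fun k _ => ?_
  have hpos : (0 : ℝ) < 1 / #s := by have := hs.card_pos; positivity
  refine (continuousOn_cpow_const_im_nonneg hpos).comp (by fun_prop) fun z hz => ?_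
  simpa using hz

theorem differentiableAt_shiftedGeomMean {z : ℂ} (hz : ∀ k ∈ s, z + a k ∈ Complex.slitPlane) :
    DifferentiableAt ℂ (shiftedGeomMean s a) z := by
  unfold shiftedGeomMean
  refine DifferentiableAt.fun_finsetProd fun k hk => ?_
  exact (differentiableAt_id.add_const _).cpow_const (hz k hk)

theorem hasDerivAt_prod_one_add_mul_cpow :
    HasDerivAt (fun u : ℂ => ∏ k ∈ s, (1 + a k * u) ^ (((1 : ℝ) / #s : ℝ) : ℂ))
      (((∑ k ∈ s, a k) / #s : ℝ) : ℂ) 0 := by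
  classical
  have h1 : ∀ k ∈ s, HasDerivAt (fun u : ℂ => (1 + a k * u) ^ (((1 : ℝ) / #s : ℝ) : ℂ))
      (a k / #s) 0 := by
    intro k _
    have h2 : HasDerivAt (fun u : ℂ => 1 + a k * u) (a k) 0 := by
      simpa using ((hasDerivAt_id (0 : ℂ)).const_mul (a k : ℂ)).const_add 1
    have h3 := h2.cpow_const (c := (((1 : ℝ) / #s : ℝ) : ℂ)) (by simp)
    convert h3 using 1
    simp
    ring
  refine (HasDerivAt.fun_finsetProd h1).congr_deriv ?_
  simp [Finset.sum_div]

theorem shiftedGeomMean_eq_mul (hs : s.Nonempty) (ha : ∀ k ∈ s, 0 < a k) {z : ℂ}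
    (hz : 0 ≤ z.im) (hlarge : ∀ k ∈ s, a k < ‖z‖) :
    shiftedGeomMean s a z
      = z * ∏ k ∈ s, (1 + a k * z⁻¹) ^ (((1 : ℝ) / #s : ℝ) : ℂ) := by
  have hcard := hs.card_pos.ne'
  have hz0 : z ≠ 0 := by
    obtain ⟨k, hk⟩ := hs
    exact norm_pos_iff.1 ((ha k hk).trans (hlarge k hk))
  have hfac : ∀ k ∈ s, (z + a k) ^ (((1 : ℝ) / #s : ℝ) : ℂ)
      = z ^ (((1 : ℝ) / #s : ℝ) : ℂ) * (1 + a k * z⁻¹) ^ (((1 : ℝ) / #s : ℝ) : ℂ) := by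
    intro k hk
    have hre : 0 < (1 + a k * z⁻¹).re := by
      have h1 : ‖(a k : ℂ) * z⁻¹‖ < 1 := by
        rw [norm_mul, norm_inv, Complex.norm_real, norm_of_nonneg (ha k hk).le, ← div_eq_mul_inv,
          div_lt_one (norm_pos_iff.2 hz0)]
        exact hlarge k hk
      have h2 := (abs_le.1 (Complex.abs_re_le_norm ((a k : ℂ) * z⁻¹))).1
      rw [Complex.add_re, Complex.one_re]
      linarith
    have hw0 : 1 + a k * z⁻¹ ≠ 0 := fun h => by simp [h] at hre
    have him : (1 + a k * z⁻¹).im ≤ 0 := by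
      have : 0 ≤ a k * (z.im / Complex.normSq z) :=
        mul_nonneg (ha k hk).le (div_nonneg hz (Complex.normSq_nonneg z))
      simp only [Complex.add_im, Complex.one_im, Complex.im_ofReal_mul,
        Complex.inv_im, neg_div, mul_neg]
      linarith
    have harg1 := abs_lt.1 (Complex.abs_arg_lt_pi_div_two_iff.2 (Or.inl hre))
    have harg2 : (1 + a k * z⁻¹).arg ≤ 0 := by
      rcases him.lt_or_eq with h | h
      · exact (Complex.arg_neg_iff.2 h).le
      · exact (Complex.arg_eq_zero_iff.2 ⟨hre.le, h⟩).le
    have harg3 := Complex.arg_nonneg_iff.2 hz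
    have harg4 := Complex.arg_le_pi z
    have hmul : z + a k = z * (1 + a k * z⁻¹) := by field_simp
    rw [hmul, Complex.cpow_def_of_ne_zero (mul_ne_zero hz0 hw0), Complex.cpow_def_of_ne_zero hz0,
      Complex.cpow_def_of_ne_zero hw0, ← Complex.exp_add, ← add_mul,
      Complex.log_mul hz0 hw0 ⟨by linarith [pi_pos], by linarith⟩]
  rw [shiftedGeomMean, Finset.prod_congr rfl hfac, Finset.prod_mul_distrib, Finset.prod_const]
  congr 1
  simpa using Complex.cpow_nat_inv_pow z hcard

theorem tendsto_shiftedGeomMean_sub_self (hs : s.Nonempty) (ha : ∀ k ∈ s, 0 < a k) :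
    Tendsto (fun z => shiftedGeomMean s a z - z) (Bornology.cobounded ℂ ⊓ 𝓟 {z | 0 ≤ z.im})
      (𝓝 (((∑ k ∈ s, a k) / #s : ℝ) : ℂ)) := by
  have h1 := ((hasDerivAt_prod_one_add_mul_cpow (s := s) (a := a)).tendsto_slope.comp
    tendsto_inv₀_cobounded').mono_left
      (inf_le_left : Bornology.cobounded ℂ ⊓ 𝓟 {z | 0 ≤ z.im} ≤ _)
  refine h1.congr' ?_
  rw [EventuallyEq, eventually_inf_principal]
  filter_upwards [(eventually_all_finset s).2 fun k _ =>
    (tendsto_norm_cobounded_atTop (E := ℂ)).eventually_gt_atTop (a k)] with z hlarge hz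
  rw [shiftedGeomMean_eq_mul hs ha hz hlarge]
  simp [slope_def_field]
  ring

theorem shiftedGeomMean_ofReal (x : ℝ) :
    shiftedGeomMean s a x = ((∏ k ∈ s, |a k + x|) ^ ((1 : ℝ) / #s) : ℝ)
      * Complex.exp (((#{k ∈ s | a k + x < 0} * π / #s : ℝ) : ℂ) * Complex.I) := by
  have hfac : ∀ k ∈ s, ((x : ℂ) + a k) ^ (((1 : ℝ) / #s : ℝ) : ℂ)
      = ((|a k + x| ^ ((1 : ℝ) / #s) : ℝ) : ℂ)
        * if a k + x < 0 then Complex.exp (((π / #s : ℝ) : ℂ) * Complex.I) else 1 := by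
    intro k _
    rw [add_comm, ← Complex.ofReal_add]
    split_ifs with h
    · rw [Complex.ofReal_cpow_of_nonpos h.le, ← Complex.ofReal_neg, ← abs_of_neg h,
        Complex.ofReal_cpow (abs_nonneg _)]
      congr 2
      push_cast
      ring
    · rw [abs_of_nonneg (not_lt.1 h), Complex.ofReal_cpow (not_lt.1 h), mul_one]
  rw [shiftedGeomMean, Finset.prod_congr rfl hfac, Finset.prod_mul_distrib, ← Complex.ofReal_prod,
    Real.finsetProd_rpow _ _ fun k _ => abs_nonneg _, ← Finset.prod_filter, Finset.prod_const,
    ← Complex.exp_nat_mul]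
  congr 2
  push_cast
  ring

theorem shiftedGeomMean_ofReal_im (x : ℝ) :
    (shiftedGeomMean s a x).im = (∏ k ∈ s, |a k + x|) ^ ((1 : ℝ) / #s)
      * Real.sin (#{k ∈ s | a k + x < 0} * π / #s) := by
  rw [shiftedGeomMean_ofReal, Complex.im_ofReal_mul, Complex.exp_ofReal_mul_I_im]

theorem shiftedGeomMean_zero (ha : ∀ k ∈ s, 0 < a k) :
    shiftedGeomMean s a 0 = ((∏ k ∈ s, a k) ^ ((1 : ℝ) / #s) : ℝ) := by
  have h1 := shiftedGeomMean_ofReal (s := s) (a := a) 0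
  rw [Finset.filter_false_of_mem fun k hk => by simpa using (ha k hk).le] at h1
  have h2 : ∏ k ∈ s, |a k| = ∏ k ∈ s, a k := Finset.prod_congr rfl fun k hk => abs_of_pos (ha k hk)
  simpa [h2] using h1

theorem continuousOn_dslope_shiftedGeomMean (hs : s.Nonempty) (ha : ∀ k ∈ s, 0 < a k) :
    ContinuousOn (dslope (shiftedGeomMean s a) 0) {z | 0 ≤ z.im} := by
  intro z hz
  by_cases h0 : z = 0
  · subst h0
    refine (continuousAt_dslope_same.2
      (differentiableAt_shiftedGeomMean fun k hk => ?_)).continuousWithinAt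
    simpa using ha k hk
  · exact (continuousWithinAt_dslope_of_ne h0).2 (continuousOn_shiftedGeomMean hs z hz)

theorem tendsto_integral_im_dslope_shiftedGeomMean (hs : s.Nonempty) (ha : ∀ k ∈ s, 0 < a k) :
    Tendsto (fun R : ℝ => ∫ x in (-R)..R, (dslope (shiftedGeomMean s a) 0 x).im) atTop
      (𝓝 (((∏ k ∈ s, a k) ^ ((1 : ℝ) / #s) - (∑ k ∈ s, a k) / #s) * π)) := by
  set G : ℝ := (∏ k ∈ s, a k) ^ ((1 : ℝ) / #s)
  set A : ℝ := (∑ k ∈ s, a k) / #s with hA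
  set F := shiftedGeomMean s a
  have hF0 : F 0 = G := shiftedGeomMean_zero ha
  have hI : ∀ z : ℂ, 0 ≤ z.im → z + Complex.I ≠ 0 := fun z hz h => by
    have := congrArg Complex.im h
    simp at this
    linarith
  have hcF := continuousOn_dslope_shiftedGeomMean hs ha
  set h : ℂ → ℂ := fun z => dslope F 0 z - 1 - ((A - G : ℝ) : ℂ) / (z + Complex.I) with hh
  have hc : ContinuousOn h {z | 0 ≤ z.im} :=
    (hcF.sub continuousOn_const).sub (continuousOn_const.div (by fun_prop) hI)
  have hd : DifferentiableOn ℂ h {z | 0 < z.im} := by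
    intro z hz
    have hz : 0 < z.im := hz
    have h0 : z ≠ 0 := fun h => by simp [h] at hz
    refine DifferentiableAt.differentiableWithinAt (.sub (.sub ?_ (by fun_prop))
      (.div (by fun_prop) (by fun_prop) (hI z hz.le)))
    refine (differentiableAt_dslope_of_ne h0).2 (differentiableAt_shiftedGeomMean fun k _ => ?_)
    refine Or.inr ?_
    simpa using hz.ne'
  have hlim : Tendsto (fun z => z * h z) (Bornology.cobounded ℂ ⊓ 𝓟 {z | 0 ≤ z.im}) (𝓝 0) := by
    have h1 : Tendsto (fun z : ℂ => (1 + Complex.I * z⁻¹)⁻¹)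
        (Bornology.cobounded ℂ ⊓ 𝓟 {z | 0 ≤ z.im}) (𝓝 1) := by
      have := ((tendsto_inv₀_cobounded (α := ℂ)).const_mul Complex.I).const_add 1
      have := this.inv₀ (by simp)
      simpa using this.mono_left inf_le_left
    have h2 := ((tendsto_shiftedGeomMean_sub_self hs ha).sub_const (G : ℂ)).sub
      (h1.const_mul ((A - G : ℝ) : ℂ))
    have h3 : (((∑ k ∈ s, a k) / #s : ℝ) : ℂ) - G - ((A - G : ℝ) : ℂ) * 1 = 0 := by
      rw [← hA]; push_cast; ring
    rw [h3] at h2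
    refine h2.congr' ?_
    rw [EventuallyEq, eventually_inf_principal]
    filter_upwards [(tendsto_norm_cobounded_atTop (E := ℂ)).eventually_gt_atTop 0] with z hz0 hz
    have hz0 : z ≠ 0 := norm_pos_iff.1 hz0
    have h4 : (1 + Complex.I * z⁻¹)⁻¹ = z / (z + Complex.I) := by
      rw [show 1 + Complex.I * z⁻¹ = (z + Complex.I) / z by field_simp, inv_div]
    rw [hh, h4]
    simp only [dslope_of_ne _ hz0, slope_def_field, hF0, sub_zero]
    change F z - z - _ - _ = _
    have := hI z hz
    field_simp
    ring
  have hreal : ∀ x : ℝ, 0 ≤ (x : ℂ).im := by simp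
  have hcont : Continuous fun x : ℝ => h x := hc.comp_continuous (by fun_prop) hreal
  have hcontF : Continuous fun x : ℝ => dslope F 0 x := hcF.comp_continuous (by fun_prop) hreal
  have hint := (Complex.continuous_im.tendsto 0).comp
    (tendsto_integral_symm_of_upperHalfPlane_decay hc hd hlim)
  have him : ∀ x : ℝ, (h x).im = (dslope F 0 x).im + (A - G) * (1 / (1 + x ^ 2)) := by
    intro x
    simp only [hh, Complex.sub_im, Complex.one_im, Complex.div_im, Complex.normSq_apply]
    simp
    ring
  have heq : ∀ R : ℝ, (∫ x in (-R)..R, (dslope F 0 x).im)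
      = (∫ x in (-R)..R, h x).im - (A - G) * (2 * Real.arctan R) := by
    intro R
    have h1 : (∫ x in (-R)..R, h x).im = ∫ x in (-R)..R, (h x).im :=
      (Complex.imCLM.intervalIntegral_comp_comm (hcont.intervalIntegrable _ _)).symm
    rw [h1]
    simp_rw [him]
    rw [intervalIntegral.integral_add, intervalIntegral.integral_const_mul,
      integral_one_div_one_add_sq, Real.arctan_neg]
    · ring
    · exact (Complex.continuous_im.comp hcontF).intervalIntegrable _ _
    · refine Continuous.intervalIntegrable ?_ _ _
      exact continuous_const.mul (continuous_const.div (by fun_prop) fun x => by positivity)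
  simp_rw [heq]
  have harc := (Real.tendsto_arctan_atTop.mono_right nhdsWithin_le_nhds)
  have := hint.sub ((harc.const_mul 2).const_mul (A - G))
  rw [Complex.zero_im] at this
  rw [show (0 : ℝ) - (A - G) * (2 * (π / 2)) = (G - A) * π by ring] at this
  exact this

end shiftedGeomMean

theorem geometric_mean_integral_representation_at_zero
    (n : ℕ) (hn : 1 ≤ n) (a : ℕ → ℝ)
    (hpos : ∀ k ∈ Finset.Icc 1 n, 0 < a k)
    (hmono : ∀ k ∈ Finset.Icc 1 (n - 1), a k ≤ a (k + 1)) :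
    (∏ k ∈ Finset.Icc 1 n, a k) ^ ((1 : ℝ) / n)
      = (∑ k ∈ Finset.Icc 1 n, a k) / n
        - (1 / Real.pi) *
          ∑ ℓ ∈ Finset.Icc 1 (n - 1),
            Real.sin (ℓ * Real.pi / n) *
              ∫ t in (a ℓ)..(a (ℓ + 1)),
                (∏ k ∈ Finset.Icc 1 n, |a k - t|) ^ ((1 : ℝ) / n) / t := by
  have hs : (Finset.Icc 1 n).Nonempty := Finset.nonempty_Icc.2 hn
  have hcard : #(Finset.Icc 1 n) = n := by simp
  have hn0 : (n : ℝ) ≠ 0 := by positivity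
  have hle : ∀ i j, 1 ≤ i → i ≤ j → j ≤ n → a i ≤ a j := by
    intro i j hi hij
    induction j, hij using Nat.le_induction with
    | base => exact fun _ => le_rfl
    | succ j hij ih =>
      intro hj
      exact (ih (by omega)).trans (hmono j (Finset.mem_Icc.2 ⟨by omega, by omega⟩))
  have h1pos : 0 < a 1 := hpos 1 (Finset.mem_Icc.2 ⟨le_rfl, hn⟩)
  set F := shiftedGeomMean (Finset.Icc 1 n) a
  set ψ : ℝ → ℝ := fun t => (dslope F 0 (-t : ℝ)).im with hψ
  have hψcont : Continuous ψ := by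
    refine Complex.continuous_im.comp
      ((continuousOn_dslope_shiftedGeomMean hs hpos).comp_continuous (by fun_prop) ?_)
    simp
  have hψint : ∀ x y, IntervalIntegrable ψ MeasureTheory.volume x y :=
    fun x y => hψcont.intervalIntegrable x y
  have hψval : ∀ t : ℝ, t ≠ 0 → ∀ m : ℕ, #{k ∈ Finset.Icc 1 n | a k < t} = m →
      ψ t = -(Real.sin (m * π / n)
        * ((∏ k ∈ Finset.Icc 1 n, |a k - t|) ^ ((1 : ℝ) / n) / t)) := by
    intro t ht m hm
    have h0 : ((-t : ℝ) : ℂ) ≠ 0 := by simpa using ht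
    have h1 := shiftedGeomMean_ofReal_im (s := Finset.Icc 1 n) (a := a) (-t)
    simp only [hcard, ← sub_eq_add_neg, sub_neg, hm] at h1
    have hF0 : F 0 = ((∏ k ∈ Finset.Icc 1 n, a k) ^ ((1 : ℝ) / #(Finset.Icc 1 n)) : ℝ) :=
      shiftedGeomMean_zero hpos
    simp only [hψ, dslope_of_ne _ h0, slope_def_field, sub_zero, Complex.div_ofReal_im, hF0,
      Complex.sub_im, Complex.ofReal_im]
    rw [h1]
    field_simp
  have hmid : ∀ ℓ ∈ Finset.Icc 1 (n - 1), (∫ t in (a ℓ)..(a (ℓ + 1)), ψ t)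
      = -(Real.sin (ℓ * π / n) * ∫ t in (a ℓ)..(a (ℓ + 1)),
          (∏ k ∈ Finset.Icc 1 n, |a k - t|) ^ ((1 : ℝ) / n) / t) := by
    intro ℓ hℓ
    have hℓ' := Finset.mem_Icc.1 hℓ
    rw [← intervalIntegral.integral_const_mul, ← intervalIntegral.integral_neg]
    refine intervalIntegral.integral_congr_uIoo fun t ht => ?_
    rw [Set.uIoo_of_le (hmono ℓ hℓ)] at ht
    have htpos : 0 < t := (hpos ℓ (Finset.mem_Icc.2 ⟨hℓ'.1, by omega⟩)).trans ht.1
    refine hψval t htpos.ne' ℓ ?_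
    have : {k ∈ Finset.Icc 1 n | a k < t} = Finset.Icc 1 ℓ := by
      ext k
      simp only [Finset.mem_filter, Finset.mem_Icc]
      constructor
      · rintro ⟨⟨hk1, hkn⟩, hkt⟩
        refine ⟨hk1, ?_⟩
        by_contra! hlt
        linarith [hle (ℓ + 1) k (by omega) hlt hkn, ht.2]
      · rintro ⟨hk1, hkl⟩
        exact ⟨⟨hk1, by omega⟩, (hle k ℓ hk1 hkl (by omega)).trans_lt ht.1⟩
    simp [this]
  have hleft : ∀ R, 0 < R → (∫ t in (-R)..(a 1), ψ t) = 0 := by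
    intro R hR
    refine intervalIntegral.integral_zero_ae ?_
    filter_upwards [MeasureTheory.Measure.ae_ne MeasureTheory.volume (0 : ℝ)] with t ht hmem
    rw [Set.uIoc_of_le (by linarith)] at hmem
    rw [hψval t ht 0]
    · simp
    · rw [Finset.card_eq_zero, Finset.filter_eq_empty_iff]
      intro k hk
      have hk := Finset.mem_Icc.1 hk
      exact not_lt.2 (hmem.2.trans (hle 1 k le_rfl hk.1 hk.2))
  have hright : ∀ R, a n ≤ R → (∫ t in (a n)..R, ψ t) = 0 := by
    intro R hR
    refine intervalIntegral.integral_zero_ae (Eventually.of_forall fun t hmem => ?_)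
    rw [Set.uIoc_of_le hR] at hmem
    have htpos : 0 < t := (hpos n (Finset.mem_Icc.2 ⟨hn, le_rfl⟩)).trans hmem.1
    rw [hψval t htpos.ne' n]
    · simp [mul_div_cancel_left₀ _ hn0]
    · rw [Finset.filter_true_of_mem, hcard]
      intro k hk
      have hk := Finset.mem_Icc.1 hk
      exact (hle k n hk.1 hk.2 le_rfl).trans_lt hmem.1
  have hIco : Finset.Icc 1 (n - 1) = Finset.Ico 1 n := by
    ext k; simp only [Finset.mem_Icc, Finset.mem_Ico]; omega
  have hsum : (∫ t in (a 1)..(a n), ψ t) = -∑ ℓ ∈ Finset.Icc 1 (n - 1),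
      Real.sin (ℓ * Real.pi / n) * ∫ t in (a ℓ)..(a (ℓ + 1)),
        (∏ k ∈ Finset.Icc 1 n, |a k - t|) ^ ((1 : ℝ) / n) / t := by
    rw [← intervalIntegral.sum_integral_adjacent_intervals_Ico hn fun k _ => hψint _ _, ← hIco,
      Finset.sum_congr rfl hmid, Finset.sum_neg_distrib]
  have hlim := tendsto_integral_im_dslope_shiftedGeomMean hs hpos
  have hev : (fun R : ℝ => ∫ x in (-R)..R, (dslope F 0 x).im)
      =ᶠ[atTop] fun _ => ∫ t in (a 1)..(a n), ψ t := by
    filter_upwards [eventually_gt_atTop 0, eventually_ge_atTop (a n)] with R hR hRn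
    have hneg := intervalIntegral.integral_comp_neg (a := -R) (b := R)
      fun x : ℝ => (dslope F 0 x).im
    rw [neg_neg] at hneg
    rw [← hneg]
    change ∫ t in (-R)..R, ψ t = _
    rw [← intervalIntegral.integral_add_adjacent_intervals (hψint (-R) (a 1)) (hψint (a 1) R),
      ← intervalIntegral.integral_add_adjacent_intervals (hψint (a 1) (a n)) (hψint (a n) R),
      hleft R hR, hright R hRn, zero_add, add_zero]
  have hfinal := tendsto_nhds_unique (hlim.congr' hev) tendsto_const_nhds
  rw [hsum, hcard] at hfinal
  have hpi := Real.pi_ne_zero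
  field_simp at hfinal ⊢
  linear_combination hfinal
end

section
/- Let 0 < a_1 ≤ a_2 and z ∈ ℂ \ (-∞, -a_1]. Then the principal square root satisfies √((a_1+z)(a_2+z)) = (a_1+a_2)/2 + z - (1/π)∫_{a_1}^{a_2} √((t - a_1)(a_2 - t)) · dt/(t+z), where the square root on the left is exp((1/2)(Log(a_1+z) + Log(a_2+z))). -/
open Real Complex intervalIntegral

/-- The exponential of half the logarithm squares to the original number. -/
lemma exp_half_log_sq {u : ℂ} (hu : u ≠ 0) : Complex.exp (1 / 2 * Complex.log u) ^ 2 = u := by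
  rw [← Complex.exp_nat_mul]
  push_cast
  rw [show (2 : ℂ) * (1 / 2 * Complex.log u) = Complex.log u by ring, Complex.exp_log hu]

/-- The principal square root maps the slit plane to the right half-plane. -/
lemma exp_half_log_re_pos {u : ℂ} (hu : u ∈ Complex.slitPlane) :
    0 < (Complex.exp (1 / 2 * Complex.log u)).re := by
  have him : (1 / 2 * Complex.log u).im = u.arg / 2 := by
    rw [show (1 / 2 : ℂ) = ((1 / 2 : ℝ) : ℂ) by push_cast; rfl, Complex.im_ofReal_mul,
      Complex.log_im]
    ring
  rw [Complex.exp_re, him]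
  have h1 : u.arg < π := lt_of_le_of_ne (Complex.arg_le_pi u) (Complex.slitPlane_arg_ne_pi hu)
  have h2 := Complex.neg_pi_lt_arg u
  exact mul_pos (Real.exp_pos _) (Real.cos_pos_of_mem_Ioo ⟨by linarith, by linarith⟩)

/-- If two points of the right half-plane have squares with the same imaginary part,
then their difference is shorter than their sum. -/
lemma norm_sub_lt_norm_add_of_sq_im_eq {a b : ℂ} (ha : 0 < a.re) (hb : 0 < b.re)
    (h : (a ^ 2).im = (b ^ 2).im) : ‖a - b‖ < ‖a + b‖ := by
  have h' : a.re * a.im = b.re * b.im := by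
    simp only [pow_two, Complex.mul_im] at h
    linarith
  have him : 0 ≤ a.im * b.im := by
    have h3 : a.re * (a.im * b.im) = b.re * b.im ^ 2 := by linear_combination b.im * h'
    exact nonneg_of_mul_nonneg_right (h3 ▸ by positivity) ha
  refine lt_of_pow_lt_pow_left₀ 2 (norm_nonneg _) ?_
  rw [Complex.sq_norm, Complex.sq_norm, Complex.normSq_apply, Complex.normSq_apply]
  simp only [Complex.add_re, Complex.add_im, Complex.sub_re, Complex.sub_im]
  nlinarith [mul_pos ha hb]

/-- Averaging over the unit circle, folded onto the upper half-circle. -/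
lemma integral_upper_half_circle_eq {g : ℂ → ℂ}
    (hg : DifferentiableOn ℂ g (Metric.closedBall 0 1)) :
    ∫ θ in (0 : ℝ)..π, (g (Complex.exp (θ * I)) + g (Complex.exp (-θ * I))) = 2 * π * g 0 := by
  have havg : circleAverage g 0 1 = g 0 := by
    refine DiffContOnCl.circleAverage ?_
    rw [abs_one]
    exact ⟨hg.mono Metric.ball_subset_closedBall,
      hg.continuousOn.mono Metric.closure_ball_subset_closedBall⟩
  have hcont : Continuous fun θ : ℝ => g (Complex.exp (θ * I)) :=
    hg.continuousOn.comp_continuous (by fun_prop) fun θ => by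
      simp [Complex.norm_exp_ofReal_mul_I]
  have hfold : ∫ θ in (0 : ℝ)..π, g (Complex.exp (-θ * I))
      = ∫ θ in π..(2 * π), g (Complex.exp (θ * I)) := by
    have := integral_comp_sub_left (a := 0) (b := π)
      (fun θ : ℝ => g (Complex.exp (θ * I))) (2 * π)
    rw [show 2 * π - π = π by ring, sub_zero] at this
    rw [← this]
    refine integral_congr fun θ _ => ?_
    congr 1
    rw [← Complex.exp_periodic (-θ * I)]
    congr 1
    push_cast
    ring
  have hcont' : Continuous fun θ : ℝ => g (Complex.exp (-θ * I)) := by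
    simpa [Function.comp_def] using hcont.comp continuous_neg
  rw [integral_add (hcont.intervalIntegrable _ _) (hcont'.intervalIntegrable _ _), hfold,
    integral_add_adjacent_intervals (hcont.intervalIntegrable _ _)
      (hcont.intervalIntegrable _ _), ← havg, circleAverage_def]
  simp only [circleMap_zero, Complex.ofReal_one, one_mul, Complex.real_smul]
  push_cast
  exact (mul_inv_cancel_left₀ (by simp) _).symm

/-- The factors `p - q * ζ` do not vanish on the closed unit disc. -/
lemma sub_mul_ne_zero_of_norm_lt {p q ζ : ℂ} (h : ‖q‖ < ‖p‖) (hζ : ‖ζ‖ ≤ 1) :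
    p - q * ζ ≠ 0 := by
  intro h0
  have : ‖p‖ ≤ ‖q‖ := by
    rw [sub_eq_zero.mp h0, norm_mul]
    exact mul_le_of_le_one_right (norm_nonneg _) hζ
  linarith

/-- The integral of `sin² θ / |p - q e^{iθ}|²`, with the denominator continued analytically. -/
lemma integral_sin_sq_div {p q : ℂ} (h : ‖q‖ < ‖p‖) :
    ∫ θ in (0 : ℝ)..π, (Real.sin θ : ℂ) ^ 2 / (p ^ 2 + q ^ 2 - 2 * p * q * Real.cos θ)
      = π / (2 * p ^ 2) := by
  have hp : p ≠ 0 := norm_pos_iff.mp ((norm_nonneg q).trans_lt h)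
  have hg : DifferentiableOn ℂ (fun ζ => (1 - ζ ^ 2) / (4 * p * (p - q * ζ)))
      (Metric.closedBall 0 1) := by
    intro ζ hζ
    have hne := sub_mul_ne_zero_of_norm_lt h (by simpa using hζ)
    exact (DifferentiableAt.div (by fun_prop) (by fun_prop) (by simp [hp, hne])).differentiableWithinAt
  have key := integral_upper_half_circle_eq hg
  rw [show π / (2 * p ^ 2) = 2 * π * ((1 - (0 : ℂ) ^ 2) / (4 * p * (p - q * 0))) by
    rw [mul_zero, sub_zero]; field_simp; ring, ← key]
  refine integral_congr fun θ _ => ?_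
  have hn1 : ‖Complex.exp (θ * I)‖ ≤ 1 := (Complex.norm_exp_ofReal_mul_I θ).le
  have hn2 : ‖Complex.exp (-θ * I)‖ ≤ 1 := by
    simpa using (Complex.norm_exp_ofReal_mul_I (-θ)).le
  have hd1 := sub_mul_ne_zero_of_norm_lt h hn1
  have hd2 := sub_mul_ne_zero_of_norm_lt h hn2
  have hmul : Complex.exp (θ * I) * Complex.exp (-θ * I) = 1 := by
    rw [← Complex.exp_add]; simp
  have hcos : (Real.cos θ : ℂ) = (Complex.exp (θ * I) + Complex.exp (-θ * I)) / 2 := by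
    rw [Complex.ofReal_cos, Complex.cos]
  have hsin : (Real.sin θ : ℂ) ^ 2
      = -(Complex.exp (θ * I) - Complex.exp (-θ * I)) ^ 2 / 4 := by
    rw [Complex.ofReal_sin, Complex.sin]
    linear_combination (Complex.exp (-θ * I) - Complex.exp (θ * I)) ^ 2 / 4 * Complex.I_sq
  rw [hcos, hsin]
  generalize Complex.exp (θ * I) = x at *
  generalize Complex.exp (-θ * I) = y at *
  have hden : p ^ 2 + q ^ 2 - 2 * p * q * ((x + y) / 2) = (p - q * x) * (p - q * y) := by
    linear_combination (-q ^ 2) * hmul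
  have h4p : 4 * p ≠ 0 := by simp [hp]
  rw [hden, div_add_div _ _ (mul_ne_zero h4p hd1) (mul_ne_zero h4p hd2),
    div_eq_div_iff (mul_ne_zero hd1 hd2) (mul_ne_zero (mul_ne_zero h4p hd1) (mul_ne_zero h4p hd2))]
  linear_combination
    4 * p * (p - q * x) * (p - q * y) * (2 * p - q * (x + y)) * hmul

/-- Substituting `t = (a₁ + a₂) / 2 - (a₂ - a₁) / 2 * cos θ`. -/
lemma integral_sqrt_mul_div_eq_integral_sin_sq {a₁ a₂ : ℝ} (h12 : a₁ ≤ a₂) {z : ℂ}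
    (hz : ∀ t ∈ Set.Icc a₁ a₂, (t : ℂ) + z ≠ 0) :
    ∫ t in a₁..a₂, ((Real.sqrt ((t - a₁) * (a₂ - t)) : ℝ) : ℂ) / ((t : ℂ) + z)
      = ∫ θ in (0 : ℝ)..π, (((a₂ - a₁) / 2 : ℝ) : ℂ) ^ 2 * ((Real.sin θ : ℂ) ^ 2 /
          ((((a₁ + a₂) / 2 : ℝ) : ℂ) + z - (((a₂ - a₁) / 2 : ℝ) : ℂ) * Real.cos θ)) := by
  set r : ℝ := (a₂ - a₁) / 2 with hr
  set m : ℝ := (a₁ + a₂) / 2 with hm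
  have hr0 : 0 ≤ r := by linarith
  have hcont : ContinuousOn (fun t : ℝ => ((Real.sqrt ((t - a₁) * (a₂ - t)) : ℝ) : ℂ) / (t + z))
      (Set.Icc a₁ a₂) :=
    ContinuousOn.div (by fun_prop) (by fun_prop) hz
  have hsub := integral_deriv_smul_comp' (a := 0) (b := π) (f := fun θ => m - r * Real.cos θ)
    (f' := fun θ => r * Real.sin θ)
    (g := fun t : ℝ => ((Real.sqrt ((t - a₁) * (a₂ - t)) : ℝ) : ℂ) / (t + z))
    (fun θ _ => by simpa using ((Real.hasDerivAt_cos θ).const_mul r).const_sub m)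
    (by fun_prop)
    (hcont.mono (by
      rintro _ ⟨θ, -, rfl⟩
      constructor <;> simp only <;>
        nlinarith [Real.neg_one_le_cos θ, Real.cos_le_one θ]))
  simp only [Real.cos_zero, Real.cos_pi] at hsub
  rw [show m - r * 1 = a₁ by rw [hm, hr]; ring, show m - r * -1 = a₂ by rw [hm, hr]; ring] at hsub
  rw [← hsub]
  refine integral_congr fun θ hθ => ?_
  rw [Set.uIcc_of_le Real.pi_pos.le] at hθ
  have hs := Real.sin_nonneg_of_mem_Icc hθ
  have hsqrt : Real.sqrt ((m - r * Real.cos θ - a₁) * (a₂ - (m - r * Real.cos θ)))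
      = r * Real.sin θ := by
    rw [show (m - r * Real.cos θ - a₁) * (a₂ - (m - r * Real.cos θ)) = (r * Real.sin θ) ^ 2 by
      rw [mul_pow, Real.sin_sq, hm, hr]; ring, Real.sqrt_sq (mul_nonneg hr0 hs)]
  simp only [Function.comp_apply, hsqrt, Complex.real_smul]
  push_cast
  rw [show (m : ℂ) - r * Complex.cos θ + z = m + z - r * Complex.cos θ by ring]
  ring

theorem sqrt_integral_representation_complex
    (a₁ a₂ : ℝ) (h1 : 0 < a₁) (h12 : a₁ ≤ a₂)
    (z : ℂ) (hz : ((a₁ : ℝ) : ℂ) + z ∈ Complex.slitPlane) :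
    Complex.exp ((1 / 2 : ℂ) *
        (Complex.log ((a₁ : ℂ) + z) + Complex.log ((a₂ : ℂ) + z)))
      = (((a₁ + a₂) / 2 : ℝ) : ℂ) + z
        - (1 / (Real.pi : ℂ)) *
          ∫ t in a₁..a₂,
            ((Real.sqrt ((t - a₁) * (a₂ - t)) : ℝ) : ℂ) / ((t : ℂ) + z) := by
  have hslit : ∀ t : ℝ, a₁ ≤ t → (t : ℂ) + z ∈ Complex.slitPlane := by
    intro t ht
    rw [Complex.mem_slitPlane_iff] at hz ⊢
    simp only [Complex.add_re, Complex.add_im, Complex.ofReal_re, Complex.ofReal_im] at hz ⊢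
    exact hz.imp_left fun h => by linarith
  have hz₂ := hslit a₂ h12
  rw [integral_sqrt_mul_div_eq_integral_sin_sq h12
    fun t ht => Complex.slitPlane_ne_zero (hslit t ht.1), mul_add, Complex.exp_add]
  have hβ := exp_half_log_sq (Complex.slitPlane_ne_zero hz)
  have hα := exp_half_log_sq (Complex.slitPlane_ne_zero hz₂)
  have hβ0 := exp_half_log_re_pos hz
  have hα0 := exp_half_log_re_pos hz₂
  generalize Complex.exp (1 / 2 * Complex.log (a₁ + z)) = β at *
  generalize Complex.exp (1 / 2 * Complex.log (a₂ + z)) = α at *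
  have hlt : ‖α - β‖ < ‖α + β‖ :=
    norm_sub_lt_norm_add_of_sq_im_eq hα0 hβ0 (by rw [hα, hβ]; simp)
  have hint := integral_sin_sq_div (p := (α + β) / 2) (q := (α - β) / 2)
    (by rw [norm_div, norm_div]; gcongr; simp)
  have hm : (((a₁ + a₂) / 2 : ℝ) : ℂ) + z = ((α + β) / 2) ^ 2 + ((α - β) / 2) ^ 2 := by
    push_cast
    linear_combination -(hα + hβ) / 2
  have hr : (((a₂ - a₁) / 2 : ℝ) : ℂ) = 2 * ((α + β) / 2) * ((α - β) / 2) := by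
    push_cast
    linear_combination (hβ - hα) / 2
  rw [intervalIntegral.integral_const_mul, hm, hr, hint]
  have hsum : α + β ≠ 0 := norm_pos_iff.mp ((norm_nonneg _).trans_lt hlt)
  have hpi : (π : ℂ) ≠ 0 := by exact_mod_cast Real.pi_ne_zero
  field_simp
  ring
end

section
/- Let 0 < a_1 ≤ a_2 ≤ ... ≤ a_n and suppose z = iy with y > 0 real. Then Im(exp((1/n)∑_{k=1}^n Log(a_k + iy))) = y + (y/π)∑_{ℓ=1}^{n-1} sin(ℓπ/n) ∫_{a_ℓ}^{a_{ℓ+1}} (∏_{k=1}^n |a_k - t|)^{1/n} dt/(t² + y²). -/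
open Finset Real Complex intervalIntegral

open Filter Topology Set in
/-- Poisson's formula at a point `i y` for a function holomorphic in the upper half-plane,
continuous up to the real line and of growth `o(|w|)` at infinity. -/
theorem tendsto_integral_poisson_upperHalfPlane {f : ℂ → ℂ} {y : ℝ} (hy : 0 < y)
    (hc : ContinuousOn f {w | 0 ≤ w.im}) (hd : DifferentiableOn ℂ f {w | 0 < w.im})
    (hlim : Tendsto (fun w => f w / w) (Bornology.cobounded ℂ ⊓ 𝓟 {w | 0 ≤ w.im}) (𝓝 0)) :
    Tendsto (fun R : ℝ => ∫ x in (-R)..R, f x / ((x : ℂ) ^ 2 + (y : ℂ) ^ 2)) atTop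
      (𝓝 ((π / y : ℝ) * f (y * I))) := by
  set c : ℂ := y * I with hc_def
  have hcim : c.im = y := by simp [c]
  have hopen : IsOpen {w : ℂ | 0 < w.im} := isOpen_lt continuous_const continuous_im
  have hcd : DifferentiableAt ℂ f c :=
    hd.differentiableAt (hopen.mem_nhds (by simpa [hcim] using hy))
  have hcc : {w : ℂ | 0 ≤ w.im} ∈ 𝓝 c :=
    mem_of_superset (hopen.mem_nhds (by simpa [hcim] using hy)) fun w hw => le_of_lt (show 0 < w.im from hw)
  have hadd : ∀ w : ℂ, 0 ≤ w.im → w + c ≠ 0 := fun w hw h => by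
    have := congrArg Complex.im h
    simp [hcim] at this
    linarith
  set g : ℂ → ℂ := fun w => dslope f c w / (w + c) with hg
  have hgc : ContinuousOn g {w | 0 ≤ w.im} :=
    ((continuousOn_dslope hcc).2 ⟨hc, hcd⟩).div (by fun_prop) hadd
  have hgd : ∀ w : ℂ, 0 < w.im → w ≠ c → DifferentiableAt ℂ g w := fun w hw hne =>
    ((differentiableAt_dslope_of_ne hne).2
      (hd.differentiableAt (hopen.mem_nhds hw))).div (by fun_prop) (hadd w hw.le)
  have hfac : ∀ w : ℂ, (w - c) * (w + c) = w ^ 2 + (y : ℂ) ^ 2 := fun w => by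
    have : I ^ 2 = -1 := I_sq
    simp only [c]; linear_combination (-(y : ℂ) ^ 2) * this
  have hgeq : ∀ w : ℂ, w ≠ c → g w = (f w - f c) / (w ^ 2 + (y : ℂ) ^ 2) := fun w hne => by
    simp only [hg]
    rw [dslope_of_ne _ hne, slope_def_field, div_div, hfac]
  have hinv : Tendsto (fun w : ℂ => w⁻¹) (Bornology.cobounded ℂ ⊓ 𝓟 {w | 0 ≤ w.im}) (𝓝 0) :=
    tendsto_inv₀_cobounded.mono_left inf_le_left
  have hwg : Tendsto (fun w => w * g w) (Bornology.cobounded ℂ ⊓ 𝓟 {w | 0 ≤ w.im}) (𝓝 0) := by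
    have h1 : Tendsto (fun w : ℂ => (f w / w - f c * w⁻¹) / (1 + ((y : ℂ) * w⁻¹) ^ 2))
        (Bornology.cobounded ℂ ⊓ 𝓟 {w | 0 ≤ w.im}) (𝓝 ((0 - f c * 0) / (1 + ((y : ℂ) * 0) ^ 2))) :=
      (hlim.sub (hinv.const_mul _)).div (((hinv.const_mul _).pow 2).const_add _) (by simp)
    rw [show (0 - f c * 0) / (1 + ((y : ℂ) * 0) ^ 2) = 0 by simp] at h1
    refine h1.congr' ?_
    have hne : ∀ᶠ w in Bornology.cobounded ℂ, w ≠ 0 ∧ w ≠ c :=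
      (Bornology.eventually_ne_cobounded 0).and (Bornology.eventually_ne_cobounded c)
    filter_upwards [hne.filter_mono inf_le_left] with w hw
    obtain ⟨hw0, hwc⟩ := hw
    rw [hgeq w hwc]
    field_simp
  have hbound : ∀ ε > 0, ∃ R₀ : ℝ, ∀ w : ℂ, R₀ ≤ ‖w‖ → 0 ≤ w.im → ‖w * g w‖ ≤ ε := by
    intro ε hε
    have h := (hasBasis_cobounded_norm.inf_principal _).eventually_iff.1
      (hwg.norm.eventually (Iic_mem_nhds (by simpa using hε : ‖(0 : ℂ)‖ < ε)))
    obtain ⟨R₀, -, h⟩ := h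
    exact ⟨R₀, fun w h1 h2 => h ⟨h1, h2⟩⟩
  have hg0 : Tendsto (fun R : ℝ => ∫ x in (-R)..R, g x) atTop (𝓝 0) := by
    rw [Metric.tendsto_atTop]
    intro ε hε
    obtain ⟨R₀, hR₀⟩ := hbound (ε / 8) (by positivity)
    refine ⟨max R₀ 1, fun R hR => ?_⟩
    have hRR : R₀ ≤ R := le_trans (le_max_left _ _) hR
    have hR1 : 1 ≤ R := le_trans (le_max_right _ _) hR
    have hRpos : 0 < R := by linarith
    have key : ∀ w : ℂ, R ≤ ‖w‖ → 0 ≤ w.im → ‖g w‖ ≤ ε / 8 / R := by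
      intro w hw hwi
      rw [le_div_iff₀ hRpos]
      calc ‖g w‖ * R ≤ ‖g w‖ * ‖w‖ := by gcongr
        _ = ‖w * g w‖ := by rw [norm_mul, mul_comm]
        _ ≤ ε / 8 := hR₀ w (hRR.trans hw) hwi
    have hrect := integral_boundary_rect_eq_zero_of_differentiable_on_off_countable g
      (⟨-R, 0⟩ : ℂ) (⟨R, R⟩ : ℂ) {c} (countable_singleton c)
      (hgc.mono fun w hw => by
        have := hw.2
        simp only [uIcc_of_le hRpos.le] at this
        exact this.1)
      (fun w hw => by
        have := hw.1.2
        simp only [min_eq_left hRpos.le] at this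
        exact hgd w this.1 hw.2)
    simp only [ofReal_zero, zero_mul, add_zero] at hrect
    have htop : ‖∫ x in (-R)..R, g (x + R * I)‖ ≤ ε / 8 / R * |R - -R| :=
      norm_integral_le_of_norm_le_const fun x _ => key _
        (by simpa [abs_of_pos hRpos] using abs_im_le_norm (x + R * I : ℂ)) (by simpa using hRpos.le)
    have hside : ∀ s : ℝ, |s| = R → ‖∫ t in (0 : ℝ)..R, g (s + t * I)‖ ≤ ε / 8 / R * |R - 0| := by
      intro s hs
      refine norm_integral_le_of_norm_le_const fun t ht => key _ ?_ ?_
      · simpa [hs] using abs_re_le_norm (s + t * I : ℂ)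
      · rw [uIoc_of_le hRpos.le] at ht
        simpa using ht.1.le
    have hright := hside R (abs_of_pos hRpos)
    have hleft := hside (-R) (by rw [abs_neg, abs_of_pos hRpos])
    have e2 : ε / 8 / R * |R - -R| = ε / 4 := by
      rw [abs_of_pos (by linarith)]; field_simp; ring
    have e1 : ε / 8 / R * |R - 0| = ε / 8 := by
      rw [sub_zero, abs_of_pos hRpos]; field_simp
    rw [e2] at htop
    rw [e1] at hright hleft
    rw [dist_zero_right]
    have heq : (∫ x in (-R)..R, g x) = (∫ x in (-R)..R, g (x + R * I))
        - I • (∫ t in (0 : ℝ)..R, g (R + t * I))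
        + I • ∫ t in (0 : ℝ)..R, g ((-R : ℝ) + t * I) := by
      linear_combination hrect
    rw [heq]
    calc _ ≤ ε / 4 + ε / 8 + ε / 8 := by
          refine (norm_add_le _ _).trans (add_le_add ((norm_sub_le _ _).trans
            (add_le_add htop ?_)) ?_)
          · simpa [norm_smul] using hright
          · simpa [norm_smul] using hleft
      _ < ε := by linarith
  have harctan : Tendsto (fun R : ℝ => ((y⁻¹ * (Real.arctan (R / y) - Real.arctan (-R / y)) : ℝ) : ℂ) * f c)
      atTop (𝓝 ((π / y : ℝ) * f c)) := by
    have h1 : Tendsto (fun R : ℝ => Real.arctan (R / y)) atTop (𝓝 (π / 2)) :=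
      (tendsto_nhds_of_tendsto_nhdsWithin tendsto_arctan_atTop).comp
        (tendsto_id.atTop_div_const hy)
    have h2 : Tendsto (fun R : ℝ => y⁻¹ * (Real.arctan (R / y) - Real.arctan (-R / y))) atTop
        (𝓝 (π / y)) := by
      have := ((h1.add h1).const_mul y⁻¹)
      rw [show y⁻¹ * (π / 2 + π / 2) = π / y by ring] at this
      refine this.congr fun R => ?_
      rw [neg_div, Real.arctan_neg, sub_neg_eq_add]
    exact ((continuous_ofReal.tendsto _).comp h2).mul_const _
  have hsum := hg0.add harctan
  rw [zero_add] at hsum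
  refine hsum.congr fun R => ?_
  rw [← integral_inv_sq_add_sq hy.ne', ← intervalIntegral.integral_ofReal,
    ← intervalIntegral.integral_mul_const, ← intervalIntegral.integral_add]
  · refine integral_congr fun x _ => ?_
    have hx : (x : ℂ) ≠ c := fun h => by
      have := congrArg Complex.im h
      simp [hcim] at this
      exact hy.ne this
    simp only [hgeq _ hx]
    push_cast
    rw [add_comm ((y : ℂ) ^ 2)]
    ring
  · exact (hgc.comp_continuous continuous_ofReal fun x => by simp).intervalIntegrable _ _
  · refine Continuous.intervalIntegrable ?_ _ _
    refine (continuous_ofReal.comp ?_).mul continuous_const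
    exact Continuous.inv₀ (by fun_prop) fun x => by positivity

/-- The principal power `w ^ α` is continuous on the closed upper half-plane. -/
theorem continuousOn_cpow_const_im_nonneg_s18 {α : ℂ} (hα : 0 < α.re) :
    ContinuousOn (fun w : ℂ => w ^ α) {w | 0 ≤ w.im} := by
  have hα0 : α ≠ 0 := fun h => by simp [h] at hα
  have hcont : ContinuousOn (fun w : ℂ => (-I * w) ^ α * cexp (π / 2 * I * α)) {w | 0 ≤ w.im} := by
    intro w hw
    refine ContinuousAt.continuousWithinAt (ContinuousAt.mul ?_ continuousAt_const)
    refine ContinuousAt.comp (f := fun w : ℂ => -I * w)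
      (continuousAt_cpow_const_of_re_pos (Or.inl ?_) hα) (by fun_prop)
    simpa using hw
  refine hcont.congr fun w hw => ?_
  rcases eq_or_ne w 0 with rfl | hw0
  · simp [hα0]
  have harg : 0 ≤ w.arg := arg_nonneg_iff.2 hw
  have hargle := arg_le_pi w
  have hlog : Complex.log (-I * w) = -(π / 2 * I) + Complex.log w := by
    rw [Complex.log_mul (by simp) hw0, Complex.log_neg_I]
    · ring
    · rw [arg_neg_I]
      constructor <;> linarith [Real.pi_pos]
  simp only
  rw [cpow_def_of_ne_zero hw0, cpow_def_of_ne_zero (by simp [hw0]), ← Complex.exp_add, hlog]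
  ring_nf

/-- In the closed upper half-plane, principal powers of `w + a` factor through those of `w`. -/
theorem ofReal_add_cpow_eq_mul {a : ℝ} (ha : 0 < a) {w : ℂ} (hw : 0 ≤ w.im) (haw : a < ‖w‖)
    (α : ℂ) : ((a : ℂ) + w) ^ α = w ^ α * (1 + a / w) ^ α := by
  have hw0 : w ≠ 0 := norm_pos_iff.1 (ha.trans haw)
  have hnorm : ‖(a : ℂ) / w‖ < 1 := by
    rw [norm_div, Complex.norm_real, Real.norm_of_nonneg ha.le, div_lt_one (ha.trans haw)]
    exact haw
  have hre : 0 < (1 + (a : ℂ) / w).re := by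
    have := (abs_le.1 (abs_re_le_norm ((a : ℂ) / w))).1
    rw [add_re, one_re]
    linarith
  have him : (1 + (a : ℂ) / w).im ≤ 0 := by
    rw [add_im, one_im, zero_add, div_im, ofReal_im, ofReal_re, zero_mul, zero_div, zero_sub,
      neg_nonpos]
    exact div_nonneg (mul_nonneg ha.le hw) (normSq_nonneg w)
  have hq0 : 1 + (a : ℂ) / w ≠ 0 := fun h => by simp [h] at hre
  have hargq : (1 + (a : ℂ) / w).arg ≤ 0 := by
    rcases him.lt_or_eq with h | h
    · exact (arg_neg_iff.2 h).le
    · exact (arg_eq_zero_iff.2 ⟨hre.le, h⟩).le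
  have hargq' := (abs_lt.1 (abs_arg_lt_pi_div_two_iff.2 (Or.inl hre))).1
  have hargw : 0 ≤ w.arg := arg_nonneg_iff.2 hw
  have hsplit : (a : ℂ) + w = w * (1 + a / w) := by field_simp; ring
  rw [hsplit, cpow_def_of_ne_zero (mul_ne_zero hw0 hq0), cpow_def_of_ne_zero hw0,
    cpow_def_of_ne_zero hq0, ← Complex.exp_add, Complex.log_mul hw0 hq0, add_mul]
  constructor <;> linarith [Real.pi_pos, arg_le_pi w]

open Filter Topology in
/-- The complex geometric mean of the numbers `a k + w` is asymptotic to `w` at infinity in the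
closed upper half-plane. -/
theorem tendsto_prod_cpow_div {n : ℕ} (hn : n ≠ 0) {a : ℕ → ℝ}
    (hpos : ∀ k ∈ Finset.Icc 1 n, 0 < a k) :
    Tendsto (fun w : ℂ => (∏ k ∈ Finset.Icc 1 n, ((a k : ℂ) + w) ^ (n : ℂ)⁻¹) / w)
      (Bornology.cobounded ℂ ⊓ 𝓟 {w | 0 ≤ w.im}) (𝓝 1) := by
  have hinv : Tendsto (fun w : ℂ => w⁻¹) (Bornology.cobounded ℂ ⊓ 𝓟 {w | 0 ≤ w.im}) (𝓝 0) :=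
    tendsto_inv₀_cobounded.mono_left inf_le_left
  have hprod : Tendsto (fun w : ℂ => ∏ k ∈ Finset.Icc 1 n, (1 + (a k : ℂ) / w) ^ (n : ℂ)⁻¹)
      (Bornology.cobounded ℂ ⊓ 𝓟 {w | 0 ≤ w.im})
      (𝓝 (∏ k ∈ Finset.Icc 1 n, (1 + (a k : ℂ) * 0) ^ (n : ℂ)⁻¹)) :=
    tendsto_finsetProd _ fun k _ =>
      ((hinv.const_mul _).const_add 1).cpow tendsto_const_nhds (by simp)
  rw [show ∏ k ∈ Finset.Icc 1 n, (1 + (a k : ℂ) * 0) ^ (n : ℂ)⁻¹ = 1 by simp] at hprod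
  refine hprod.congr' ?_
  have hlarge : ∀ᶠ w : ℂ in Bornology.cobounded ℂ, w ≠ 0 ∧ ∀ k ∈ Finset.Icc 1 n, a k < ‖w‖ :=
    (Bornology.eventually_ne_cobounded 0).and ((Filter.eventually_all_finset _).2 fun k _ =>
      tendsto_norm_cobounded_atTop.eventually_gt_atTop (a k))
  filter_upwards [hlarge.filter_mono inf_le_left,
    (eventually_principal.2 fun _ h => h : ∀ᶠ w in 𝓟 {w : ℂ | 0 ≤ w.im}, 0 ≤ w.im).filter_mono
      inf_le_right] with w hw him
  rw [Finset.prod_congr rfl fun k hk => ofReal_add_cpow_eq_mul (hpos k hk) him (hw.2 k hk) _,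
    Finset.prod_mul_distrib, Finset.prod_const, Nat.card_Icc, Nat.add_sub_cancel,
    cpow_nat_inv_pow _ hn, mul_div_cancel_left₀ _ hw.1]

/-- Boundary values of the complex geometric mean on the negative real axis. -/
theorem im_prod_cpow_ofReal {n l : ℕ} (hl : l ≤ n) {a : ℕ → ℝ} {t : ℝ}
    (hlt : ∀ k ∈ Finset.Icc 1 l, a k ≤ t) (hge : ∀ k ∈ Finset.Ioc l n, t ≤ a k) :
    (∏ k ∈ Finset.Icc 1 n, ((a k : ℂ) + ((-t : ℝ) : ℂ)) ^ (n : ℂ)⁻¹).im =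
      Real.sin (l * π / n) * (∏ k ∈ Finset.Icc 1 n, |a k - t|) ^ ((1 : ℝ) / n) := by
  have hterm : ∀ k ∈ Finset.Icc 1 n, ((a k : ℂ) + ((-t : ℝ) : ℂ)) ^ (n : ℂ)⁻¹ =
      ((|a k - t| ^ ((1 : ℝ) / n) : ℝ) : ℂ) * if k ≤ l then cexp (π * I * (n : ℂ)⁻¹) else 1 := by
    intro k hk
    rw [Finset.mem_Icc] at hk
    rw [← ofReal_add, ofReal_cpow (abs_nonneg _), ← sub_eq_add_neg]
    push_cast
    split_ifs with h
    · have := hlt k (Finset.mem_Icc.2 ⟨hk.1, h⟩)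
      rw [abs_of_nonpos (by linarith), ← ofReal_sub, ofReal_cpow_of_nonpos (by linarith)]
      push_cast
      rw [one_div]
    · have := hge k (Finset.mem_Ioc.2 ⟨not_le.1 h, hk.2⟩)
      rw [abs_of_nonneg (by linarith)]
      push_cast
      rw [one_div, mul_one]
  have hcard : ((Finset.Icc 1 n).filter (· ≤ l)).card = l := by
    rw [show (Finset.Icc 1 n).filter (· ≤ l) = Finset.Icc 1 l by ext k; simp; omega]
    simp
  rw [Finset.prod_congr rfl hterm, Finset.prod_mul_distrib, Finset.prod_ite, Finset.prod_const,
    Finset.prod_const_one, mul_one, hcard, ← ofReal_prod,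
    Real.finsetProd_rpow _ _ (fun _ _ => abs_nonneg _), im_ofReal_mul, ← Complex.exp_nat_mul,
    show (l : ℂ) * (π * I * (n : ℂ)⁻¹) = ((l * π / n : ℝ) : ℂ) * I by push_cast; ring,
    exp_ofReal_mul_I_im, mul_comm]

theorem imaginary_part_on_imaginary_axis
    (n : ℕ) (hn : 1 ≤ n) (a : ℕ → ℝ)
    (hpos : ∀ k ∈ Finset.Icc 1 n, 0 < a k)
    (hmono : ∀ k ∈ Finset.Icc 1 (n - 1), a k ≤ a (k + 1))
    (y : ℝ) (hy : 0 < y) :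
    (Complex.exp ((1 / (n : ℂ)) *
        ∑ k ∈ Finset.Icc 1 n,
          Complex.log (((a k : ℝ) : ℂ) + (y : ℂ) * Complex.I))).im
      = y + (y / Real.pi) *
          ∑ ℓ ∈ Finset.Icc 1 (n - 1),
            Real.sin (ℓ * Real.pi / n) *
              ∫ t in (a ℓ)..(a (ℓ + 1)),
                (∏ k ∈ Finset.Icc 1 n, |a k - t|) ^ ((1 : ℝ) / n) /
                  (t ^ 2 + y ^ 2) := by
  have hn0 : n ≠ 0 := by omega
  have hle : ∀ i j, 1 ≤ i → i ≤ j → j ≤ n → a i ≤ a j := by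
    intro i j hi hij
    induction j, hij using Nat.le_induction with
    | base => exact fun _ => le_rfl
    | succ j hj ih =>
      exact fun hjn => (ih (by omega)).trans (hmono j (Finset.mem_Icc.2 ⟨by omega, by omega⟩))
  set F : ℂ → ℂ := fun w => ∏ k ∈ Finset.Icc 1 n, ((a k : ℂ) + w) ^ (n : ℂ)⁻¹ with hF
  have hre : 0 < ((n : ℂ)⁻¹).re := by
    rw [← ofReal_natCast, ← ofReal_inv, ofReal_re]
    positivity
  have hFc : ContinuousOn F {w | 0 ≤ w.im} := continuousOn_finsetProd _ fun k _ =>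
    (continuousOn_cpow_const_im_nonneg_s18 hre).comp (f := fun w : ℂ => (a k : ℂ) + w) (by fun_prop)
      fun w hw => by simpa using hw
  have hFd : DifferentiableOn ℂ F {w | 0 < w.im} := fun w hw =>
    DifferentiableAt.differentiableWithinAt <| DifferentiableAt.fun_finsetProd fun k _ =>
      DifferentiableAt.cpow_const (by fun_prop)
        (Or.inr (by simpa using (show 0 < w.im from hw).ne'))
  have hlim : Filter.Tendsto (fun w => (F w - w) / w)
      (Bornology.cobounded ℂ ⊓ Filter.principal {w | 0 ≤ w.im}) (nhds 0) := by
    have h := (tendsto_prod_cpow_div hn0 hpos).sub_const 1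
    rw [sub_self] at h
    refine h.congr' ?_
    filter_upwards [(Bornology.eventually_ne_cobounded (0 : ℂ)).filter_mono inf_le_left] with w hw
    rw [sub_div, div_self hw]
  have hpoisson := tendsto_integral_poisson_upperHalfPlane hy (hFc.sub continuousOn_id)
    (hFd.sub differentiableOn_id) hlim
  simp only [id, Pi.sub_apply] at hpoisson
  have hden : ∀ t : ℝ, t ^ 2 + y ^ 2 ≠ 0 := fun t => by positivity
  have hFreal : Continuous fun x : ℝ => F x :=
    hFc.comp_continuous continuous_ofReal fun x => by simp
  set ψ : ℝ → ℝ := fun t => (F ((-t : ℝ) : ℂ)).im / (t ^ 2 + y ^ 2) with hψ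
  have hψc : Continuous ψ :=
    (continuous_im.comp (hFreal.comp continuous_neg)).div (by fun_prop) hden
  have hψval : ∀ l ≤ n, ∀ t, (∀ k ∈ Finset.Icc 1 l, a k ≤ t) → (∀ k ∈ Finset.Ioc l n, t ≤ a k) →
      ψ t = Real.sin (l * π / n) *
        ((∏ k ∈ Finset.Icc 1 n, |a k - t|) ^ ((1 : ℝ) / n) / (t ^ 2 + y ^ 2)) := by
    intro l hl t h1 h2
    simp only [hψ, hF]
    rw [im_prod_cpow_ofReal hl h1 h2, mul_div_assoc]
  have hψleft : ∀ t ≤ a 1, ψ t = 0 := fun t ht => by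
    rw [hψval 0 (by omega) t (by simp) fun k hk => by
      rw [Finset.mem_Ioc] at hk
      exact ht.trans (hle 1 k le_rfl hk.1 hk.2)]
    simp
  have hψright : ∀ t, a n ≤ t → ψ t = 0 := fun t ht => by
    rw [hψval n le_rfl t (fun k hk => by
      rw [Finset.mem_Icc] at hk
      exact (hle k n hk.1 hk.2 le_rfl).trans ht) (by simp), mul_div_cancel_left₀ _ (by simpa)]
    simp
  have hψsum : ∑ l ∈ Finset.Icc 1 (n - 1), Real.sin (l * π / n) *
      ∫ t in (a l)..(a (l + 1)), (∏ k ∈ Finset.Icc 1 n, |a k - t|) ^ ((1 : ℝ) / n) /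
        (t ^ 2 + y ^ 2) = ∫ t in (a 1)..(a n), ψ t := by
    rw [← sum_integral_adjacent_intervals_Ico hn fun k _ => hψc.intervalIntegrable _ _,
      show Finset.Icc 1 (n - 1) = Finset.Ico 1 n by ext; simp; omega]
    refine Finset.sum_congr rfl fun l hl => ?_
    rw [Finset.mem_Ico] at hl
    rw [← intervalIntegral.integral_const_mul]
    refine integral_congr fun t ht => ?_
    rw [Set.uIcc_of_le (hle l (l + 1) hl.1 (by omega) (by omega))] at ht
    refine (hψval l (by omega) t (fun k hk => ?_) fun k hk => ?_).symm
    · rw [Finset.mem_Icc] at hk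
      exact (hle k l hk.1 hk.2 (by omega)).trans ht.1
    · rw [Finset.mem_Ioc] at hk
      exact ht.2.trans (hle (l + 1) k (by omega) hk.1 hk.2)
  have hev : ∀ᶠ R : ℝ in Filter.atTop,
      (∫ x in (-R)..R, (F x - x) / ((x : ℂ) ^ 2 + (y : ℂ) ^ 2)).im = ∫ t in (a 1)..(a n), ψ t := by
    filter_upwards [Filter.eventually_ge_atTop (a n), Filter.eventually_ge_atTop (-a 1)] with R h1 h2
    have hquot : Continuous fun x : ℝ => (F x - x) / ((x : ℂ) ^ 2 + (y : ℂ) ^ 2) :=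
      (hFreal.sub continuous_ofReal).div (by fun_prop) fun x => by exact_mod_cast hden x
    have him := intervalIntegral.intervalIntegral_im (𝕜 := ℂ)
      (hquot.intervalIntegrable (μ := MeasureTheory.volume) (-R) R)
    simp only [RCLike.im_eq_complex_im] at him
    have hzero : ∀ u v : ℝ, u ≤ v → (∀ t ∈ Set.Icc u v, ψ t = 0) → ∫ t in u..v, ψ t = 0 :=
      fun u v huv h => by
        rw [integral_congr (g := fun _ => 0) fun t ht => h t (by rwa [Set.uIcc_of_le huv] at ht)]
        simp
    have hcongr : ∀ t : ℝ, ((F ((-t : ℝ) : ℂ) - ((-t : ℝ) : ℂ)) /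
        (((-t : ℝ) : ℂ) ^ 2 + (y : ℂ) ^ 2)).im = ψ t := fun t => by
      rw [← ofReal_pow, ← ofReal_pow, ← ofReal_add, div_ofReal_im, sub_im, ofReal_im, sub_zero,
        neg_sq]
    have hneg := intervalIntegral.integral_comp_neg (a := -R) (b := R)
      fun x : ℝ => ((F x - x) / ((x : ℂ) ^ 2 + (y : ℂ) ^ 2)).im
    simp only [hcongr, neg_neg] at hneg
    rw [← him, ← hneg,
      ← integral_add_adjacent_intervals (hψc.intervalIntegrable (-R) (a 1))
        (hψc.intervalIntegrable (a 1) R),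
      ← integral_add_adjacent_intervals (hψc.intervalIntegrable (a 1) (a n))
        (hψc.intervalIntegrable (a n) R),
      hzero (-R) (a 1) (by linarith) fun t ht => hψleft t ht.2,
      hzero (a n) R h1 fun t ht => hψright t ht.1, zero_add, add_zero]
  have hlimit := tendsto_nhds_unique
    (((continuous_im.tendsto _).comp hpoisson).congr' hev) tendsto_const_nhds
  rw [im_ofReal_mul, sub_im, im_ofReal_mul, I_im, mul_one] at hlimit
  have hexp : Complex.exp ((1 / (n : ℂ)) *
      ∑ k ∈ Finset.Icc 1 n, Complex.log (((a k : ℝ) : ℂ) + (y : ℂ) * Complex.I)) = F (y * I) := by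
    rw [Finset.mul_sum, Complex.exp_sum]
    refine Finset.prod_congr rfl fun k _ => ?_
    have hk : (a k : ℂ) + y * I ≠ 0 := fun h => hy.ne' (by simpa using congrArg Complex.im h)
    rw [cpow_def_of_ne_zero hk, one_div, mul_comm]
  rw [hexp, hψsum, ← hlimit]
  field_simp
  ring
end
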